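/- arXiv:1010.3448 — 13 statements merged into one kernel-verified Lean document; each statement's English description precedes it below -/
import Mathlib

section
/- Let {⟨α_i,α_i'⟩}_{i∈I} be a full, interior disjoint, unlinked countable collection of segment pairings on [0,L], with induced relation R and chain semi-metric d^R. Then d^R(0,L) = 0; that is, for every ε > 0 there exists an R-chain from 0 to L of length less than ε. (This is the statement that the endpoints of a plain arc are identified in the quotient of a paper-folding scheme.) -/
open Set

/-- A countable collection of segment pairings on the interval `[0, L]`:
the `i`-th pairing identifies the subinterval `[a i, b i]` with the subinterval
`[c i, d i]` (of the same positive length) in a length-preserving,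
orientation-reversing way. -/
structure SegPairings (L : ℝ) where
  ι : Type
  countable : Countable ι
  a : ι → ℝ
  b : ι → ℝ
  c : ι → ℝ
  d : ι → ℝ
  ha : ∀ i, 0 ≤ a i
  hbL : ∀ i, b i ≤ L
  hc : ∀ i, 0 ≤ c i
  hdL : ∀ i, d i ≤ L
  len_eq : ∀ i, b i - a i = d i - c i
  len_pos : ∀ i, 0 < b i - a i

namespace SegPairings

variable {L : ℝ} (P : SegPairings L)

/-- The open interiors of the segments of the pairings, indexed by `ι × Bool`. -/
def seg (p : P.ι × Bool) : Set ℝ :=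
  if p.2 then Set.Ioo (P.c p.1) (P.d p.1) else Set.Ioo (P.a p.1) (P.b p.1)

/-- The collection is interior disjoint: the open interiors of all of the
segments `α_i`, `α_i'` are pairwise disjoint. -/
def InteriorDisjoint : Prop :=
  Pairwise fun p q => Disjoint (P.seg p) (P.seg q)

/-- The collection is full: the total length of the pairings is `L`. -/
def Full : Prop := ∑' i, 2 * (P.b i - P.a i) = L

/-- `x` and `y` are paired by the `i`-th pairing (orientation-reversing
identification of `[a i, b i]` with `[c i, d i]`). -/
def PairedBy (i : P.ι) (x y : ℝ) : Prop :=
  ∃ t, 0 ≤ t ∧ t ≤ P.b i - P.a i ∧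
    ((x = P.a i + t ∧ y = P.d i - t) ∨ (y = P.a i + t ∧ x = P.d i - t))

/-- The reflexive symmetric relation induced by the collection of pairings. -/
def R (x y : ℝ) : Prop := x = y ∨ ∃ i, P.PairedBy i x y

/-- The set of lengths of `R`-chains from `x` to `y`. -/
def chainLengths (x y : ℝ) : Set ℝ :=
  {l | ∃ (k : ℕ) (p q : ℕ → ℝ), P.R x (p 0) ∧ (∀ i < k, P.R (q i) (p (i+1))) ∧
    P.R (q k) y ∧ l = ∑ i ∈ Finset.range (k+1), |p i - q i|}

/-- The chain semi-metric `d^R` induced by the collection of pairings. -/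
noncomputable def dR (x y : ℝ) : ℝ := sInf (P.chainLengths x y)

end SegPairings

/-- Two pairs of points `{x, x'}` and `{y, y'}` of `[0, L]` are unlinked: one of the
pairs is contained in the closure of a single connected component of the complement
(in `[0, L]`) of the other pair. -/
def UnlinkedPairs (x x' y y' : ℝ) : Prop :=
  (max y y' ≤ min x x' ∨ (min x x' ≤ min y y' ∧ max y y' ≤ max x x') ∨ max x x' ≤ min y y') ∨
  (max x x' ≤ min y y' ∨ (min y y' ≤ min x x' ∧ max x x' ≤ max y y') ∨ max y y' ≤ min x x')

/-- The collection of pairings is unlinked: points paired by two different pairings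
always form unlinked pairs. -/
def SegPairings.Unlinked {L : ℝ} (P : SegPairings L) : Prop :=
  ∀ i j, i ≠ j → ∀ x x' y y', P.PairedBy i x x' → P.PairedBy j y y' →
    UnlinkedPairs x x' y y'

namespace SegPairings

variable {L : ℝ} (P : SegPairings L)

lemma chainLengths_nonneg {x y l : ℝ} (h : l ∈ P.chainLengths x y) : 0 ≤ l := by
  obtain ⟨k, p, q, -, -, -, rfl⟩ := h
  exact Finset.sum_nonneg fun _ _ => abs_nonneg _

lemma abs_sub_mem_chainLengths (x y : ℝ) : |x - y| ∈ P.chainLengths x y :=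
  ⟨0, fun _ => x, fun _ => y, Or.inl rfl, by simp, Or.inl rfl, by simp⟩

/-- Prepend one step to a chain. -/
lemma abs_sub_add_mem_chainLengths {v x u y l : ℝ} (hv : P.R v x)
    (h : l ∈ P.chainLengths u y) : |x - u| + l ∈ P.chainLengths v y := by
  obtain ⟨k, p, q, h0, h1, h2, rfl⟩ := h
  refine ⟨k + 1, fun n => Nat.casesOn n x p, fun n => Nat.casesOn n u q, hv, ?_, h2, ?_⟩
  · rintro (_ | i) hi
    · exact h0
    · exact h1 i (by omega)
  · rw [Finset.sum_range_succ' _ (k + 1), add_comm]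
    rfl

/-- The common length of the two segments of a pairing. -/
def width (i : P.ι) : ℝ := P.b i - P.a i

/-- The leftmost point of the two segments of a pairing. -/
noncomputable def left (i : P.ι) : ℝ := min (P.a i) (P.c i)

/-- The rightmost point of the two segments of a pairing. -/
noncomputable def right (i : P.ι) : ℝ := max (P.b i) (P.d i)

lemma left_right_cases (i : P.ι) :
    (P.left i = P.a i ∧ P.right i = P.d i) ∨ (P.left i = P.c i ∧ P.right i = P.b i) := by
  have := P.len_eq i
  rcases le_total (P.a i) (P.c i) with h | h
  · exact Or.inl ⟨min_eq_left h, max_eq_right (by linarith)⟩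
  · exact Or.inr ⟨min_eq_right h, max_eq_left (by linarith)⟩

lemma pairedBy_left_right (i : P.ι) {t : ℝ} (h0 : 0 ≤ t) (ht : t ≤ P.width i) :
    P.PairedBy i (P.left i + t) (P.right i - t) := by
  have := P.len_eq i
  unfold width at ht
  rcases P.left_right_cases i with ⟨h1, h2⟩ | ⟨h1, h2⟩ <;> rw [h1, h2]
  · exact ⟨t, h0, ht, Or.inl ⟨rfl, rfl⟩⟩
  · exact ⟨P.b i - P.a i - t, by linarith, by linarith,
      Or.inr ⟨by linarith, by linarith⟩⟩

variable {P}

lemma InteriorDisjoint.le_or_le (h : P.InteriorDisjoint) {p q : P.ι × Bool} (hpq : p ≠ q)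
    {a b c d : ℝ} (hp : P.seg p = Ioo a b) (hq : P.seg q = Ioo c d) (hab : a < b) (hcd : c < d) :
    b ≤ c ∨ d ≤ a := by
  have : Disjoint (P.seg p) (P.seg q) := h hpq
  rw [hp, hq, Ioo_disjoint_Ioo, min_le_iff, le_max_iff, le_max_iff] at this
  rcases this with (h | h) | (h | h)
  · exact absurd h hab.not_ge
  · exact Or.inl h
  · exact Or.inr h
  · exact absurd h hcd.not_ge

/-- Some labelling of the two segments of a pairing by booleans lists them in order. -/
lemma exists_seg_eq (i : P.ι) : ∃ s : Bool,
    P.seg (i, s) = Ioo (P.left i) (P.left i + P.width i) ∧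
    P.seg (i, !s) = Ioo (P.right i - P.width i) (P.right i) := by
  have := P.len_eq i
  rcases P.left_right_cases i with ⟨h1, h2⟩ | ⟨h1, h2⟩
  · refine ⟨false, ?_, ?_⟩ <;> simp only [seg, width, h1, h2] <;> simp <;> (congr 1; linarith)
  · refine ⟨true, ?_, ?_⟩ <;> simp only [seg, width, h1, h2] <;> simp <;> (congr 1; linarith)

lemma InteriorDisjoint.left_add_le (h : P.InteriorDisjoint) (i : P.ι) :
    P.left i + 2 * P.width i ≤ P.right i := by
  obtain ⟨s, h1, h2⟩ := exists_seg_eq i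
  have hw : 0 < P.width i := P.len_pos i
  have hl : P.left i + P.width i ≤ P.right i := by
    have := P.len_eq i
    unfold left right width
    linarith [min_le_left (P.a i) (P.c i), le_max_left (P.b i) (P.d i)]
  rcases h.le_or_le (by simp) h1 h2 (by linarith) (by linarith) with h | h <;> linarith

/-- The hulls of two different pairings are separated or nested. -/
lemma separated_or_nested (h : P.InteriorDisjoint) (hu : P.Unlinked) {i j : P.ι} (hij : i ≠ j) :
    P.right i ≤ P.left j ∨ P.right j ≤ P.left i ∨
    (P.left i + P.width i ≤ P.left j ∧ P.right j ≤ P.right i - P.width i) ∨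
    (P.left j + P.width j ≤ P.left i ∧ P.right i ≤ P.right j - P.width j) := by
  obtain ⟨s, h1, h2⟩ := exists_seg_eq i
  obtain ⟨t, h3, h4⟩ := exists_seg_eq j
  have hi : 0 < P.width i := P.len_pos i
  have hj : 0 < P.width j := P.len_pos j
  have hli := h.left_add_le i
  have hlj := h.left_add_le j
  have key : ∀ u v : Bool, (i, u) ≠ (j, v) := fun u v e => hij (congrArg Prod.fst e)
  have e1 := h.le_or_le (key _ _) h1 h3 (by linarith) (by linarith)
  have e2 := h.le_or_le (key _ _) h1 h4 (by linarith) (by linarith)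
  have e3 := h.le_or_le (key _ _) h2 h3 (by linarith) (by linarith)
  have e4 := h.le_or_le (key _ _) h2 h4 (by linarith) (by linarith)
  have hun := hu i j hij _ _ _ _
    (P.pairedBy_left_right i (t := P.width i / 2) (by linarith) (by linarith))
    (P.pairedBy_left_right j (t := P.width j / 2) (by linarith) (by linarith))
  unfold UnlinkedPairs at hun
  rw [min_eq_left (by linarith : P.left i + P.width i / 2 ≤ P.right i - P.width i / 2),
    max_eq_right (by linarith : P.left i + P.width i / 2 ≤ P.right i - P.width i / 2),
    min_eq_left (by linarith : P.left j + P.width j / 2 ≤ P.right j - P.width j / 2),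
    max_eq_right (by linarith : P.left j + P.width j / 2 ≤ P.right j - P.width j / 2)] at hun
  grind

/-- Finitely many pairings shorten the distance between the ends of an interval containing them
by at least their total length. -/
lemma exists_chainLength_le (h : P.InteriorDisjoint) (hu : P.Unlinked) (F : Finset P.ι) :
    ∀ x y : ℝ, x ≤ y → (∀ i ∈ F, x ≤ P.left i ∧ P.right i ≤ y) →
      ∃ l ∈ P.chainLengths x y, l ≤ y - x - ∑ i ∈ F, 2 * P.width i := by
  classical
  induction F using Finset.strongInduction with
  | H F ih =>
  intro x y hxy hF
  rcases F.eq_empty_or_nonempty with rfl | hne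
  · exact ⟨_, P.abs_sub_mem_chainLengths x y, by
      rw [abs_sub_comm, abs_of_nonneg (sub_nonneg.2 hxy)]; simp⟩
  obtain ⟨i, hi, hmin⟩ := F.exists_min_image P.left hne
  have hw : 0 < P.width i := P.len_pos i
  have hl := h.left_add_le i
  obtain ⟨hxi, hiy⟩ := hF i hi
  set G := F.erase i with hG
  have hGF : G ⊂ F := Finset.erase_ssubset hi
  let inside : P.ι → Prop := fun j => P.right j ≤ P.right i - P.width i
  have hcases : ∀ j ∈ G, P.right i ≤ P.left j ∨
      (P.left i + P.width i ≤ P.left j ∧ P.right j ≤ P.right i - P.width i) := by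
    intro j hj
    obtain ⟨hji, hjF⟩ := Finset.mem_erase.1 hj
    have h1 := hmin j hjF
    have h2 := h.left_add_le j
    have h3 : 0 < P.width j := P.len_pos j
    rcases separated_or_nested h hu hji.symm with e | e | e | e
    · exact Or.inl e
    · linarith
    · exact Or.inr e
    · linarith
  obtain ⟨m, hm, hmle⟩ := ih (G.filter inside)
    ((Finset.filter_subset _ _).trans_ssubset hGF) (P.left i + P.width i)
    (P.right i - P.width i) (by linarith) (by
      intro j hj
      obtain ⟨hjG, hin⟩ := Finset.mem_filter.1 hj
      have hin : P.right j ≤ P.right i - P.width i := hin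
      have h2 := h.left_add_le j
      have h3 : 0 < P.width j := P.len_pos j
      rcases hcases j hjG with e | e
      · linarith
      · exact e)
  obtain ⟨l, hl', hlle⟩ := ih (G.filter fun j => ¬ inside j)
    ((Finset.filter_subset _ _).trans_ssubset hGF) (P.right i) y hiy (by
      intro j hj
      obtain ⟨hjG, hout⟩ := Finset.mem_filter.1 hj
      exact ⟨(hcases j hjG).resolve_right fun e => hout e.2,
        (hF j (Finset.mem_of_mem_erase hjG)).2⟩)
  have hR : P.R (P.left i) (P.right i) :=
    Or.inr ⟨i, by simpa using P.pairedBy_left_right i le_rfl hw.le⟩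
  refine ⟨_, P.abs_sub_add_mem_chainLengths (Or.inl rfl)
    (P.abs_sub_add_mem_chainLengths (u := P.right i) hR hl'), ?_⟩
  have hm0 := P.chainLengths_nonneg hm
  have hsum := Finset.sum_filter_add_sum_filter_not G inside fun j => 2 * P.width j
  have hsumF := Finset.add_sum_erase F (fun j => 2 * P.width j) hi
  rw [abs_sub_comm, abs_of_nonneg (sub_nonneg.2 hxi), sub_self, abs_zero]
  simp only [← hG] at hsumF
  linarith

end SegPairings

/-- The endpoints of a plain arc are identified: for a full, interior disjoint,
unlinked countable collection of segment pairings on `[0, L]`, the chain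
semi-metric distance between `0` and `L` is zero. -/
theorem stmt1 {L : ℝ} (hL : 0 < L) (P : SegPairings L)
    (hfull : P.Full) (hdisj : P.InteriorDisjoint) (hunl : P.Unlinked) :
    P.dR 0 L = 0 := by
  have hbdd : BddBelow (P.chainLengths 0 L) := ⟨0, fun _ => P.chainLengths_nonneg⟩
  refine le_antisymm (le_of_forall_pos_le_add fun ε hε => ?_)
    (Real.sInf_nonneg fun _ => P.chainLengths_nonneg)
  have hsum : HasSum (fun i => 2 * P.width i) L := by
    have hs : Summable fun i => 2 * P.width i := by
      by_contra hs
      exact hL.ne ((tsum_eq_zero_of_not_summable hs).symm.trans hfull)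
    exact hs.hasSum_iff.2 hfull
  obtain ⟨F, hF⟩ := (hsum.eventually (lt_mem_nhds (sub_lt_self L hε))).exists
  obtain ⟨l, hl, hle⟩ := SegPairings.exists_chainLength_le hdisj hunl F 0 L hL.le
    fun i _ => ⟨le_min (P.ha i) (P.hc i), max_le (P.hbL i) (P.hdL i)⟩
  exact (csInf_le hbdd hl).trans (by linarith)
end

section
/- Let (X,d) be a compact metric space whose metric is intrinsic, and let R be a reflexive symmetric relation on X with chain semi-metric d^R. Let S be the quotient of X by the equivalence relation d^R(x,y) = 0, which is a metric space with the metric induced by d^R. Then the metric on S is strictly intrinsic: for all p, q ∈ S there exists a continuous path in S from p to q whose length equals the distance from p to q. (This is the Metric Structure Theorem: the quotient metric on a paper space is strictly intrinsic.) -/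
open Set ENNReal

/-- The infimum of the lengths (total variations) of continuous paths in `X`
from `x` to `y`, as an extended real. -/
noncomputable def pathLengthInf {X : Type*} [PseudoMetricSpace X] (x y : X) : ℝ≥0∞ :=
  ⨅ γ : {γ : ℝ → X // ContinuousOn γ (Set.Icc 0 1) ∧ γ 0 = x ∧ γ 1 = y},
    eVariationOn γ.1 (Set.Icc 0 1)

/-- The metric of `X` is intrinsic: the distance between any two points is the
infimum of the lengths of continuous paths joining them. -/
def IsIntrinsic (X : Type*) [PseudoMetricSpace X] : Prop :=
  ∀ x y : X, pathLengthInf x y = ENNReal.ofReal (dist x y)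

/-- The set of lengths of `R`-chains from `x` to `y` in a metric space. -/
def chainLengths {X : Type*} [PseudoMetricSpace X] (R : X → X → Prop) (x y : X) : Set ℝ :=
  {l | ∃ (k : ℕ) (p q : ℕ → X), R x (p 0) ∧ (∀ i < k, R (q i) (p (i+1))) ∧ R (q k) y ∧
    l = ∑ i ∈ Finset.range (k+1), dist (p i) (q i)}

/-- The chain semi-metric `d^R` induced by a relation `R` on a metric space. -/
noncomputable def dR {X : Type*} [PseudoMetricSpace X] (R : X → X → Prop) (x y : X) : ℝ :=
  sInf (chainLengths R x y)

open Filter Topology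

theorem dR_le_of_mem {X : Type*} [PseudoMetricSpace X] {R : X → X → Prop} {x y : X} {l : ℝ}
    (hl : l ∈ chainLengths R x y) : dR R x y ≤ l := by
  refine csInf_le ⟨0, ?_⟩ hl
  rintro _ ⟨k, p, q, -, -, -, rfl⟩
  exact Finset.sum_nonneg fun _ _ => dist_nonneg

theorem dist_mem_chainLengths {X : Type*} [PseudoMetricSpace X] {R : X → X → Prop}
    (hrefl : ∀ x, R x x) (x y : X) : dist x y ∈ chainLengths R x y :=
  ⟨0, fun _ => x, fun _ => y, hrefl x, by simp, hrefl y, by simp⟩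

theorem dR_le_dist {X : Type*} [PseudoMetricSpace X] {R : X → X → Prop}
    (hrefl : ∀ x, R x x) (x y : X) : dR R x y ≤ dist x y :=
  dR_le_of_mem (dist_mem_chainLengths hrefl x y)

theorem dR_nonpos_of_rel {X : Type*} [PseudoMetricSpace X] {R : X → X → Prop}
    (hrefl : ∀ x, R x x) {x y : X} (h : R x y) : dR R x y ≤ 0 :=
  dR_le_of_mem ⟨0, fun _ => x, fun _ => x, hrefl x, by simp, h, by simp⟩

/-- The points `p` and `q` are at distance at most `l`, and whenever `l ≤ a + b` there is a point
within `a` of `p` and within `b` of `q`. -/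
def Splits {S : Type*} [PseudoMetricSpace S] (p q : S) (l : ℝ) : Prop :=
  dist p q ≤ l ∧ ∀ a b : ℝ, 0 ≤ a → 0 ≤ b → l ≤ a + b → ∃ z, dist p z ≤ a ∧ dist z q ≤ b

theorem Splits.add {S : Type*} [PseudoMetricSpace S] {p q r : S} {l m : ℝ}
    (h₁ : Splits p q l) (h₂ : Splits q r m) : Splits p r (l + m) := by
  refine ⟨(dist_triangle p q r).trans (add_le_add h₁.1 h₂.1), fun a b ha hb hab => ?_⟩
  rcases le_total a l with hal | hal
  · obtain ⟨z, hz₁, hz₂⟩ := h₁.2 a (l - a) ha (by linarith) (by linarith)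
    exact ⟨z, hz₁, by linarith [dist_triangle z q r, h₂.1]⟩
  · obtain ⟨z, hz₁, hz₂⟩ := h₂.2 (a - l) b (by linarith) hb (by linarith)
    exact ⟨z, by linarith [dist_triangle p q z, h₁.1], hz₂⟩

/-- In a compact space, approximate betweenness can be made exact. -/
theorem exists_between_of_approx {S : Type*} [PseudoMetricSpace S] [CompactSpace S]
    {p q : S} {a b : ℝ}
    (h : ∀ ε > 0, ∃ z, dist p z ≤ a + ε ∧ dist z q ≤ b + ε) :
    ∃ z, dist p z ≤ a ∧ dist z q ≤ b := by
  have hc : Continuous fun z : S => max (dist p z - a) (dist z q - b) := by fun_prop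
  obtain ⟨z, -, hz⟩ := isCompact_univ.exists_isMinOn ⟨p, mem_univ p⟩ hc.continuousOn
  have hz0 : max (dist p z - a) (dist z q - b) ≤ 0 := by
    refine le_of_forall_pos_le_add fun ε hε => ?_
    obtain ⟨w, hw₁, hw₂⟩ := h ε hε
    refine (hz (mem_univ w)).trans (max_le ?_ ?_) <;> linarith
  obtain ⟨h₁, h₂⟩ := max_le_iff.1 hz0
  exact ⟨z, by linarith, by linarith⟩

/-- In an intrinsic space, points can be approximately split at any ratio. -/
theorem IsIntrinsic.exists_approx_between {X : Type*} [PseudoMetricSpace X] (hX : IsIntrinsic X)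
    {x y : X} {a b ε : ℝ} (ha : 0 ≤ a) (hb : 0 ≤ b) (hε : 0 < ε) (hab : dist x y ≤ a + b) :
    ∃ z, dist x z ≤ a ∧ dist z y ≤ b + ε := by
  rcases le_total (dist x y) a with hd | hd
  · exact ⟨y, hd, by simp; linarith⟩
  have hlt : pathLengthInf x y < ENNReal.ofReal (dist x y + ε) := by
    rw [hX x y]
    exact (ENNReal.ofReal_lt_ofReal_iff (by positivity)).2 (by linarith)
  obtain ⟨⟨γ, hγ, h0, h1⟩, hlen⟩ := iInf_lt_iff.1 hlt
  have hcont : ContinuousOn (fun s => dist x (γ s)) (Icc 0 1) := by fun_prop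
  obtain ⟨s, hs, hsa⟩ : a ∈ (fun s => dist x (γ s)) '' Icc (0 : ℝ) 1 := by
    refine intermediate_value_Icc zero_le_one hcont ⟨?_, ?_⟩ <;> simpa [h0, h1]
  have hsum : edist x (γ s) + edist (γ s) y ≤ ENNReal.ofReal (dist x y + ε) := by
    refine le_trans ?_ hlen.le
    have hadd := eVariationOn.Icc_add_Icc γ hs.1 hs.2 hs
    rw [inter_self] at hadd
    rw [← hadd, ← h0, ← h1]
    exact add_le_add (eVariationOn.edist_le γ (by simp [hs.1]) (by simp [hs.1, hs.2]))
      (eVariationOn.edist_le γ (by simp [hs.1, hs.2]) (by simp [hs.2]))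
  rw [edist_dist, edist_dist, ← ENNReal.ofReal_add dist_nonneg dist_nonneg,
    ENNReal.ofReal_le_ofReal_iff (by positivity)] at hsum
  simp only at hsa
  exact ⟨γ s, hsa.le, by linarith⟩

/-- A `1`-Lipschitz map from an intrinsic space to a compact space sends pairs of points to
pairs that split at their original distance. -/
theorem IsIntrinsic.splits_map {X S : Type*} [PseudoMetricSpace X] [PseudoMetricSpace S]
    [CompactSpace S] (hX : IsIntrinsic X) {f : X → S} (hf : ∀ x y, dist (f x) (f y) ≤ dist x y)
    (x y : X) : Splits (f x) (f y) (dist x y) := by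
  refine ⟨hf x y, fun a b ha hb hab => exists_between_of_approx fun ε hε => ?_⟩
  obtain ⟨z, hz₁, hz₂⟩ := hX.exists_approx_between ha hb hε hab
  exact ⟨f z, by linarith [hf x z], by linarith [hf z y]⟩

theorem splits_sum {S : Type*} [PseudoMetricSpace S] {u v : ℕ → S} {l : ℕ → ℝ}
    (h : ∀ i, Splits (u i) (v i) (l i)) (k : ℕ) (heq : ∀ i < k, v i = u (i + 1)) :
    Splits (u 0) (v k) (∑ i ∈ Finset.range (k + 1), l i) := by
  induction k with
  | zero => simpa using h 0
  | succ k ih =>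
    rw [Finset.sum_range_succ]
    refine (ih fun i hi => heq i (hi.trans k.lt_succ_self)).add ?_
    rw [heq k k.lt_succ_self]
    exact h (k + 1)

/-- If balls split exactly, two points are joined by finite sequences with small steps. -/
theorem exists_seq_of_between {S : Type*} [PseudoMetricSpace S]
    (hS : ∀ (p q : S) (a b : ℝ), 0 ≤ a → 0 ≤ b → dist p q ≤ a + b →
      ∃ z, dist p z ≤ a ∧ dist z q ≤ b) {h : ℝ} (hh : 0 ≤ h) (n : ℕ) :
    ∀ p q : S, dist p q ≤ n * h →
      ∃ u : ℕ → S, u 0 = p ∧ dist (u n) q ≤ 0 ∧ ∀ i < n, dist (u i) (u (i + 1)) ≤ h := by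
  induction n with
  | zero => exact fun p q hpq => ⟨fun _ => p, rfl, by simpa using hpq, by simp⟩
  | succ n ih =>
    intro p q hpq
    push_cast at hpq
    obtain ⟨z, hz₁, hz₂⟩ := hS p q h (n * h) hh (by positivity) (by linarith)
    obtain ⟨u, hu0, hun, hu⟩ := ih z q hz₂
    refine ⟨fun i => Nat.casesOn i p u, rfl, hun, fun i hi => ?_⟩
    cases i with
    | zero => simpa [hu0] using hz₁
    | succ i => exact hu i (by omega)

/-- A map on `[0, 1]` that is Lipschitz up to an additive error of size `dist p q / n`. -/
theorem exists_approx_geodesic {S : Type*} [MetricSpace S]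
    (hS : ∀ (p q : S) (a b : ℝ), 0 ≤ a → 0 ≤ b → dist p q ≤ a + b →
      ∃ z, dist p z ≤ a ∧ dist z q ≤ b) (p q : S) {n : ℕ} (hn : n ≠ 0) :
    ∃ γ : ℝ → S, γ 0 = p ∧ γ 1 = q ∧ ∀ s t, 0 ≤ s → s ≤ t → t ≤ 1 →
      dist (γ s) (γ t) ≤ dist p q * (t - s) + dist p q / n := by
  have hn0 : (n : ℝ) ≠ 0 := Nat.cast_ne_zero.2 hn
  obtain ⟨u, hu0, hun, hu⟩ := exists_seq_of_between hS (h := dist p q / n) (by positivity) n p q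
    (by rw [mul_div_cancel₀ _ hn0])
  refine ⟨fun t => u ⌊n * t⌋₊, by simpa, by simpa using hun, fun s t hs hst ht => ?_⟩
  have hmono : ⌊n * s⌋₊ ≤ ⌊n * t⌋₊ := Nat.floor_mono (by gcongr)
  have htn : ⌊n * t⌋₊ ≤ n := Nat.floor_le_of_le (by nlinarith [n.cast_nonneg (α := ℝ)])
  have hd := dist_le_Ico_sum_of_dist_le hmono (f := u) (d := fun _ => dist p q / n)
    fun _ hk => hu _ (hk.trans_le htn)
  rw [Finset.sum_const, Nat.card_Ico, nsmul_eq_mul, Nat.cast_sub hmono] at hd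
  have h₁ : (⌊n * t⌋₊ : ℝ) ≤ n * t := Nat.floor_le (by have := hs.trans hst; positivity)
  have h₂ : n * s < ⌊n * s⌋₊ + 1 := Nat.lt_floor_add_one _
  calc _ ≤ _ := hd
    _ ≤ (n * (t - s) + 1) * (dist p q / n) := by gcongr; linarith
    _ = _ := by field_simp

/-- A compact metric space in which balls split exactly is geodesic. -/
theorem exists_geodesic_of_between {S : Type*} [MetricSpace S] [CompactSpace S]
    (hS : ∀ (p q : S) (a b : ℝ), 0 ≤ a → 0 ≤ b → dist p q ≤ a + b →
      ∃ z, dist p z ≤ a ∧ dist z q ≤ b) (p q : S) :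
    ∃ γ : ℝ → S, γ 0 = p ∧ γ 1 = q ∧ LipschitzOnWith (nndist p q) γ (Icc 0 1) := by
  choose g hg0 hg1 hg using fun n : ℕ => exists_approx_geodesic hS p q n.succ_ne_zero
  let U : Ultrafilter ℕ := hyperfilter ℕ
  have hU : (U : Filter ℕ) ≤ atTop := Nat.hyperfilter_le_atTop
  have hlim : ∀ t, ∃ z, Tendsto (fun n => g n t) U (𝓝 z) := fun t => by
    obtain ⟨z, -, hz⟩ := isCompact_univ.ultrafilter_le_nhds (U.map fun n => g n t) (by simp)
    exact ⟨z, hz⟩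
  choose γ hγ using hlim
  have hle : ∀ s t, 0 ≤ s → s ≤ t → t ≤ 1 → dist (γ s) (γ t) ≤ dist p q * (t - s) := by
    intro s t hs hst ht
    have herr : Tendsto (fun n : ℕ => dist p q / (n.succ : ℝ)) U (𝓝 0) :=
      ((tendsto_const_div_atTop_nhds_zero_nat _).comp (tendsto_add_atTop_nat 1)).mono_left hU
    have hr := herr.const_add (dist p q * (t - s))
    rw [add_zero] at hr
    exact le_of_tendsto_of_tendsto' ((hγ s).dist (hγ t)) hr fun n => hg n s t hs hst ht
  refine ⟨γ, ?_, ?_, LipschitzOnWith.of_dist_le_mul fun s hs t ht => ?_⟩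
  · exact tendsto_nhds_unique (hγ 0) (by simp [hg0])
  · exact tendsto_nhds_unique (hγ 1) (by simp [hg1])
  · rw [coe_nndist]
    rcases le_total s t with h | h
    · rw [dist_comm s, Real.dist_eq, abs_of_nonneg (sub_nonneg.2 h)]
      exact hle s t hs.1 h ht.2
    · rw [dist_comm, Real.dist_eq, abs_of_nonneg (sub_nonneg.2 h)]
      exact hle t s ht.1 h hs.2

theorem eVariationOn_eq_of_lipschitzOnWith_nndist {S : Type*} [PseudoMetricSpace S] {γ : ℝ → S}
    (hγ : LipschitzOnWith (nndist (γ 0) (γ 1)) γ (Icc 0 1)) :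
    eVariationOn γ (Icc 0 1) = edist (γ 0) (γ 1) := by
  refine le_antisymm ?_ (eVariationOn.edist_le γ (by simp) (by simp))
  have hid : eVariationOn (id : ℝ → ℝ) (Icc 0 1) ≤ 1 := by
    have := (monotone_id.monotoneOn (Icc (0 : ℝ) 1)).eVariationOn_eq
      (left_mem_Icc.2 zero_le_one) (right_mem_Icc.2 zero_le_one)
    rw [inter_self] at this
    simp [this]
  calc eVariationOn (γ ∘ id) (Icc 0 1)
      ≤ nndist (γ 0) (γ 1) * eVariationOn (id : ℝ → ℝ) (Icc 0 1) :=
        hγ.comp_eVariationOn_le (mapsTo_id _)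
    _ ≤ nndist (γ 0) (γ 1) * 1 := by gcongr
    _ = edist (γ 0) (γ 1) := by rw [mul_one, edist_nndist]

/-- Metric Structure Theorem: the quotient of a compact intrinsic metric space `X` by
the chain semi-metric of a reflexive symmetric relation `R` (realized by a metric
space `S` together with a surjection `pr : X → S` with `dist (pr x) (pr y) = d^R(x,y)`)
is strictly intrinsic: any two points of `S` are joined by a continuous path whose
length equals the distance between them. -/
theorem stmt5 {X : Type*} [MetricSpace X] [CompactSpace X]
    (hintr : IsIntrinsic X)
    (R : X → X → Prop) (hrefl : ∀ x, R x x) (hsymm : ∀ x y, R x y → R y x)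
    {S : Type*} [MetricSpace S] (pr : X → S) (hsurj : Function.Surjective pr)
    (hdist : ∀ x y : X, dist (pr x) (pr y) = dR R x y) :
    ∀ p q : S, ∃ γ : ℝ → S, ContinuousOn γ (Set.Icc 0 1) ∧ γ 0 = p ∧ γ 1 = q ∧
      eVariationOn γ (Set.Icc 0 1) = ENNReal.ofReal (dist p q) := by
  have hle : ∀ x y, dist (pr x) (pr y) ≤ dist x y := fun x y =>
    (hdist x y).trans_le (dR_le_dist hrefl x y)
  have hrel : ∀ x y, R x y → pr x = pr y := fun x y h =>
    dist_le_zero.1 ((hdist x y).trans_le (dR_nonpos_of_rel hrefl h))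
  have hcont : Continuous pr := (LipschitzWith.mk_one hle).continuous
  have : CompactSpace S := hsurj.compactSpace hcont
  have hS : ∀ (p q : S) (a b : ℝ), 0 ≤ a → 0 ≤ b → dist p q ≤ a + b →
      ∃ z, dist p z ≤ a ∧ dist z q ≤ b := by
    intro p q a b ha hb hab
    obtain ⟨x, rfl⟩ := hsurj p
    obtain ⟨y, rfl⟩ := hsurj q
    refine exists_between_of_approx fun ε hε => ?_
    obtain ⟨l, ⟨k, u, v, hu, huv, hv, rfl⟩, hl⟩ :=
      exists_lt_of_csInf_lt (b := a + b + ε) ⟨_, dist_mem_chainLengths (R := R) hrefl x y⟩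
        (show dR R x y < _ by rw [← hdist]; linarith)
    have hsplit := splits_sum (fun i => hintr.splits_map hle (u i) (v i)) k
      fun i hi => hrel _ _ (huv i hi)
    rw [← hrel _ _ hu, hrel _ _ hv] at hsplit
    obtain ⟨z, hz₁, hz₂⟩ := hsplit.2 a (b + ε) ha (by linarith) (by linarith)
    exact ⟨z, by linarith, hz₂⟩
  intro p q
  obtain ⟨γ, rfl, rfl, hγ⟩ := exists_geodesic_of_between hS p q
  exact ⟨γ, hγ.continuousOn, rfl, rfl,
    (eVariationOn_eq_of_lipschitzOnWith_nndist hγ).trans (edist_dist _ _)⟩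
end

section
/- Suppose that there exist λ > 1 and constants C₂ ≥ C₁ > 0 such that C₁ λ^{−j} ≤ a_j ≤ C₂ λ^{−j} for all j ≥ 1. Then there exist C₃ > 0 and r₀ ∈ (0, a_1) such that m(r) ≤ C₃ · r · ln(1/r) for all r ∈ (0, r₀); consequently the Lebesgue integral ∫_0^{r₀} dr / m(r) diverges (equals +∞). -/
open Set MeasureTheory ENNReal

/-- `N(r) = max { j ≥ 1 : a_j ≥ r }`. -/
noncomputable def Nfun (a : ℕ → ℝ) (r : ℝ) : ℕ := sSup {j | 1 ≤ j ∧ r ≤ a j}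

/-- `m(r) = 2 r N(r) + 2 ∑_{j > N(r)} a_j`, the measure of the ball of radius `r`
about the branch point of the `∞`-od with edge lengths `a_j`. -/
noncomputable def mfun (a : ℕ → ℝ) (r : ℝ) : ℝ :=
  2 * r * (Nfun a r : ℝ) + 2 * ∑' j : ℕ, if Nfun a r < j then a j else 0

/-- If `r ≤ C / lam ^ j` with `lam > 1`, then `j ln lam ≤ ln C + ln (1/r)`. -/
lemma mul_log_le_of_le_div_pow {lam C r : ℝ} (hlam : 1 < lam) (hC : 0 < C) (hr : 0 < r)
    {j : ℕ} (h : r ≤ C / lam ^ j) :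
    (j : ℝ) * Real.log lam ≤ Real.log C + Real.log (1 / r) := by
  have hl : 0 < lam ^ j := by positivity
  have h1 : Real.log r ≤ Real.log (C / lam ^ j) := Real.log_le_log hr h
  rw [Real.log_div hC.ne' hl.ne', Real.log_pow] at h1
  rw [one_div, Real.log_inv]
  linarith

lemma bddAbove_setOf_le_of_le_div_pow {a : ℕ → ℝ} {lam C r : ℝ} (hlam : 1 < lam) (hC : 0 < C)
    (hr : 0 < r) (h : ∀ j : ℕ, 1 ≤ j → a j ≤ C / lam ^ j) :
    BddAbove {j | 1 ≤ j ∧ r ≤ a j} := by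
  refine ⟨⌈(Real.log C + Real.log (1 / r)) / Real.log lam⌉₊, ?_⟩
  rintro j ⟨hj, hrj⟩
  have h1 := mul_log_le_of_le_div_pow hlam hC hr (hrj.trans (h j hj))
  rw [← le_div_iff₀ (Real.log_pos hlam)] at h1
  exact_mod_cast h1.trans (Nat.le_ceil _)

/-- The tail of a sequence dominated by a geometric one is at most the geometric tail. -/
lemma tsum_ite_lt_le_of_le_div_pow {a : ℕ → ℝ} {lam C : ℝ} (hlam : 1 < lam)
    (hpos : ∀ j, 1 ≤ j → 0 < a j) (h : ∀ j : ℕ, 1 ≤ j → a j ≤ C / lam ^ j) (N : ℕ) :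
    (∑' j : ℕ, if N < j then a j else 0) ≤ C / lam ^ (N + 1) * (1 - lam⁻¹)⁻¹ := by
  have hinj : Function.Injective fun j : ℕ => j + (N + 1) := add_left_injective _
  have hsupp : (Function.support fun j : ℕ => if N < j then a j else 0) ⊆
      Set.range fun j : ℕ => j + (N + 1) := by
    intro j hj
    have hN : N < j := by
      by_contra hN
      simp [hN] at hj
    exact ⟨j - (N + 1), by simp only; omega⟩
  have hlt : ∀ j, N < j + (N + 1) := fun j => by omega
  rw [← hinj.tsum_eq hsupp]
  simp only [hlt, if_true]
  have hg := (hasSum_geometric_of_lt_one (inv_nonneg.2 (by linarith))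
    (inv_lt_one_of_one_lt₀ hlam)).mul_left (C / lam ^ (N + 1))
  have hle : ∀ j, a (j + (N + 1)) ≤ C / lam ^ (N + 1) * lam⁻¹ ^ j := fun j => by
    refine (h _ (by omega)).trans_eq ?_
    rw [inv_pow, pow_add lam j, div_eq_mul_inv, div_eq_mul_inv, mul_inv]
    ring
  have hs : Summable fun j => a (j + (N + 1)) :=
    hg.summable.of_nonneg_of_le (fun j => (hpos _ (by omega)).le) hle
  exact (hs.tsum_le_tsum hle hg.summable).trans_eq hg.tsum_eq

/-- `1 / (r ln (1/r))` is not integrable near `0`. -/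
lemma not_integrableOn_one_div_mul_log {r₀ : ℝ} (hr₀ : 0 < r₀) :
    ¬ IntegrableOn (fun r : ℝ => 1 / (r * Real.log (1 / r))) (Set.Ioo 0 r₀) := by
  have hlog : Filter.Tendsto (fun r : ℝ => -Real.log r) (nhdsWithin 0 (Set.Ioi 0)) Filter.atTop :=
    Filter.tendsto_neg_atBot_atTop.comp Real.tendsto_log_nhdsGT_zero
  have hder : ∀ᶠ r : ℝ in nhdsWithin 0 (Set.Ioi 0),
      HasDerivAt (fun r => Real.log (-Real.log r)) (-r⁻¹ / (-Real.log r)) r := by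
    filter_upwards [hlog.eventually_gt_atTop 0, self_mem_nhdsWithin] with r h1 h2
    exact (Real.hasDerivAt_log (ne_of_gt h2)).neg.log h1.ne'
  refine not_integrableOn_of_tendsto_norm_atTop_of_deriv_isBigO_filter
    (f := fun r => Real.log (-Real.log r)) (nhdsWithin 0 (Set.Ioi 0))
    (Ioo_mem_nhdsGT hr₀) (hder.mono fun r h => h.differentiableAt)
    (tendsto_norm_atTop_atTop.comp (Real.tendsto_log_atTop.comp hlog)) ?_
  refine Asymptotics.IsBigO.of_bound 1 (hder.mono fun r h => ?_)
  rw [h.deriv, one_mul, one_div, one_div, Real.log_inv, mul_inv, div_eq_mul_inv, norm_mul, norm_mul,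
    norm_neg]

/-- If `0 < f r ≤ C r ln (1/r)` on `(0, r₀)` with `r₀ ≤ 1`, then `∫_0^{r₀} dr / f(r) = ∞`. -/
lemma lintegral_one_div_eq_top_of_le_mul_log {f : ℝ → ℝ} {C r₀ : ℝ} (hC : 0 < C) (hr₀ : 0 < r₀)
    (hr₀1 : r₀ ≤ 1) (hpos : ∀ r, 0 < r → r < r₀ → 0 < f r)
    (hle : ∀ r, 0 < r → r < r₀ → f r ≤ C * r * Real.log (1 / r)) :
    ∫⁻ r in Set.Ioo (0 : ℝ) r₀, ENNReal.ofReal (1 / f r) = ⊤ := by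
  by_contra hfin
  let g : ℝ → ℝ := fun r => C⁻¹ * (1 / (r * Real.log (1 / r)))
  have hmono : ∫⁻ r in Set.Ioo (0 : ℝ) r₀, ENNReal.ofReal (g r) ≤
      ∫⁻ r in Set.Ioo (0 : ℝ) r₀, ENNReal.ofReal (1 / f r) := by
    refine setLIntegral_mono' measurableSet_Ioo fun r hr => ENNReal.ofReal_le_ofReal ?_
    calc g r = 1 / (C * r * Real.log (1 / r)) := by
          simp only [g, one_div, mul_inv, mul_assoc]
      _ ≤ 1 / f r := one_div_le_one_div_of_le (hpos r hr.1 hr.2) (hle r hr.1 hr.2)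
  have hmeas : Measurable g := by fun_prop
  have hnonneg : 0 ≤ᵐ[volume.restrict (Set.Ioo 0 r₀)] g := by
    filter_upwards [ae_restrict_mem measurableSet_Ioo] with r hr
    have hlog : 0 ≤ Real.log (1 / r) :=
      Real.log_nonneg ((one_le_div hr.1).2 (hr.2.le.trans hr₀1))
    have := hr.1
    simp only [Pi.zero_apply, g]
    positivity
  have hint : Integrable g (volume.restrict (Set.Ioo 0 r₀)) :=
    (lintegral_ofReal_ne_top_iff_integrable hmeas.aestronglyMeasurable hnonneg).1
      (ne_top_of_le_ne_top hfin hmono)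
  refine not_integrableOn_one_div_mul_log hr₀ ((hint.const_mul C).congr (Filter.Eventually.of_forall
    fun r => ?_))
  simp only [g]
  rw [mul_inv_cancel_left₀ hC.ne']

/-- If the edge lengths satisfy `a_j ≍ λ^{-j}` for some `λ > 1`, then
`m(r) ≤ C₃ r ln(1/r)` near `0`, and consequently `∫_0 dr/m(r)` diverges. -/
theorem stmt6 (a : ℕ → ℝ)
    (hpos : ∀ j, 1 ≤ j → 0 < a j)
    (hmono : ∀ j, 1 ≤ j → a (j+1) ≤ a j)
    (hsum : Summable fun j => a (j+1))
    (lam : ℝ) (hlam : 1 < lam)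
    (C₁ C₂ : ℝ) (hC₁ : 0 < C₁) (hC₁₂ : C₁ ≤ C₂)
    (hbound : ∀ j : ℕ, 1 ≤ j → C₁ / lam ^ j ≤ a j ∧ a j ≤ C₂ / lam ^ j) :
    ∃ C₃ : ℝ, 0 < C₃ ∧ ∃ r₀ : ℝ, 0 < r₀ ∧ r₀ < a 1 ∧
      (∀ r : ℝ, 0 < r → r < r₀ → mfun a r ≤ C₃ * r * Real.log (1 / r)) ∧
      ∫⁻ r in Set.Ioo (0:ℝ) r₀, ENNReal.ofReal (1 / mfun a r) = ⊤ := by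
  have hC₂ : 0 < C₂ := hC₁.trans_le hC₁₂
  have hup : ∀ j : ℕ, 1 ≤ j → a j ≤ C₂ / lam ^ j := fun j hj => (hbound j hj).2
  have ha1 : 0 < a 1 := hpos 1 le_rfl
  have hloglam : 0 < Real.log lam := Real.log_pos hlam
  have hgeo : 0 < (1 - lam⁻¹)⁻¹ := inv_pos.2 (sub_pos.2 (inv_lt_one_of_one_lt₀ hlam))
  set K : ℝ := C₂ / C₁ * (1 - lam⁻¹)⁻¹ with hK
  have hKpos : 0 < K := by positivity
  set A : ℝ := (|Real.log C₂| + 1) / Real.log lam with hA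
  have hApos : 0 < A := by positivity
  set r₀ : ℝ := min (a 1 / 2) (Real.exp (-1)) with hr₀
  have hr₀pos : 0 < r₀ := lt_min (by linarith) (Real.exp_pos _)
  have hr₀a : r₀ < a 1 := (min_le_left _ _).trans_lt (by linarith)
  have hr₀1 : r₀ ≤ 1 := (min_le_right _ _).trans (Real.exp_le_one_iff.2 (by norm_num))
  have hmem : ∀ r, 0 < r → r < r₀ → 1 ≤ Nfun a r ∧ r ≤ a (Nfun a r) := fun r hr hrr =>
    Nat.sSup_mem (s := {j | 1 ≤ j ∧ r ≤ a j}) ⟨1, le_rfl, (hrr.trans hr₀a).le⟩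
      (bddAbove_setOf_le_of_le_div_pow hlam hC₂ hr hup)
  have hle : ∀ r, 0 < r → r < r₀ → mfun a r ≤ (2 * A + 2 * K) * r * Real.log (1 / r) := by
    intro r hr hrr
    obtain ⟨hN1, hN⟩ := hmem r hr hrr
    have hL : 1 ≤ Real.log (1 / r) := by
      rw [one_div, Real.log_inv, le_neg, Real.log_le_iff_le_exp hr]
      exact hrr.le.trans (min_le_right _ _)
    have hNle : (Nfun a r : ℝ) ≤ A * Real.log (1 / r) := by
      have h := mul_log_le_of_le_div_pow hlam hC₂ hr (hN.trans (hup _ hN1))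
      rw [hA, div_mul_eq_mul_div, le_div_iff₀ hloglam]
      nlinarith [le_abs_self (Real.log C₂), abs_nonneg (Real.log C₂)]
    have hsucc : a (Nfun a r + 1) < r := by
      by_contra! h
      have : Nfun a r + 1 ≤ Nfun a r :=
        le_csSup (bddAbove_setOf_le_of_le_div_pow hlam hC₂ hr hup) ⟨by omega, h⟩
      omega
    have hpow : C₂ / lam ^ (Nfun a r + 1) ≤ C₂ / C₁ * r := by
      have h := ((hbound (Nfun a r + 1) (by omega)).1.trans_lt hsucc).le
      calc C₂ / lam ^ (Nfun a r + 1) = C₂ / C₁ * (C₁ / lam ^ (Nfun a r + 1)) := by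
            field_simp
        _ ≤ C₂ / C₁ * r := by gcongr
    have htail : (∑' j : ℕ, if Nfun a r < j then a j else 0) ≤ K * r := by
      calc _ ≤ C₂ / lam ^ (Nfun a r + 1) * (1 - lam⁻¹)⁻¹ :=
            tsum_ite_lt_le_of_le_div_pow hlam hpos hup _
        _ ≤ C₂ / C₁ * r * (1 - lam⁻¹)⁻¹ := by gcongr
        _ = K * r := by rw [hK]; ring
    calc mfun a r ≤ 2 * r * (A * Real.log (1 / r)) + 2 * (K * r * 1) := by
          rw [mfun, mul_one]; gcongr
      _ ≤ 2 * r * (A * Real.log (1 / r)) + 2 * (K * r * Real.log (1 / r)) := by gcongr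
      _ = (2 * A + 2 * K) * r * Real.log (1 / r) := by ring
  have hmpos : ∀ r, 0 < r → r < r₀ → 0 < mfun a r := by
    intro r hr hrr
    have hN : (0 : ℝ) < Nfun a r := by exact_mod_cast (hmem r hr hrr).1
    have htail : 0 ≤ ∑' j : ℕ, if Nfun a r < j then a j else 0 := by
      refine tsum_nonneg fun j => ?_
      split_ifs with h
      · exact (hpos j (by omega)).le
      · exact le_rfl
    rw [mfun]
    positivity
  exact ⟨2 * A + 2 * K, by positivity, r₀, hr₀pos, hr₀a, hle,
    lintegral_one_div_eq_top_of_le_mul_log (by positivity) hr₀pos hr₀1 hmpos hle⟩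
end

section
/- Suppose that there exist k > 1 and constants C₂ ≥ C₁ > 0 such that C₁ j^{−k} ≤ a_j ≤ C₂ j^{−k} for all j ≥ 1. Then there exist C₃ > 0 and r₀ ∈ (0, a_1) such that m(r) ≥ C₃ · r^{1 − 1/k} for all r ∈ (0, r₀); consequently the Lebesgue integral ∫_0^{r₀} dr / m(r) is finite. -/
open Set MeasureTheory ENNReal

/-- An upper bound `a j ≤ C j ^ (-k)` makes the set defining `Nfun a r` bounded above. -/
theorem bddAbove_setOf_le {a : ℕ → ℝ} {k C r : ℝ} (hk : 0 < k) (hC : 0 < C) (hr : 0 < r)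
    (h : ∀ j : ℕ, 1 ≤ j → a j ≤ C * (j : ℝ) ^ (-k)) :
    BddAbove {j : ℕ | 1 ≤ j ∧ r ≤ a j} := by
  refine ⟨⌊(C / r) ^ k⁻¹⌋₊, ?_⟩
  rintro j ⟨hj, hrj⟩
  have hj0 : (0 : ℝ) < j := by exact_mod_cast hj
  apply Nat.le_floor
  rw [Real.le_rpow_inv_iff_of_pos hj0.le (by positivity) hk, le_div_iff₀ hr]
  have hle := hrj.trans (h j hj)
  rwa [Real.rpow_neg hj0.le, ← div_eq_mul_inv, le_div_iff₀ (by positivity), mul_comm] at hle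

/-- A two-sided power bound on `a` gives a lower power bound on `Nfun a`. -/
theorem rpow_le_two_mul_Nfun {a : ℕ → ℝ} {k C C' r : ℝ} (hk : 0 < k) (hC : 0 < C) (hC' : 0 < C')
    (hr : 0 < r) (hrC : r ≤ C)
    (h : ∀ j : ℕ, 1 ≤ j → C * (j : ℝ) ^ (-k) ≤ a j)
    (h' : ∀ j : ℕ, 1 ≤ j → a j ≤ C' * (j : ℝ) ^ (-k)) :
    (C / r) ^ k⁻¹ ≤ 2 * (Nfun a r : ℝ) := by
  have hx : 1 ≤ (C / r) ^ k⁻¹ :=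
    Real.one_le_rpow ((one_le_div hr).2 hrC) (inv_pos.2 hk).le
  set n := ⌊(C / r) ^ k⁻¹⌋₊
  have hn1 : 1 ≤ n := Nat.le_floor (by simpa using hx)
  have hn0 : (1 : ℝ) ≤ n := by exact_mod_cast hn1
  have hnle : (n : ℝ) ≤ (C / r) ^ k⁻¹ := Nat.floor_le (by positivity)
  have hmem : r ≤ a n := by
    refine le_trans ?_ (h n hn1)
    rw [Real.le_rpow_inv_iff_of_pos (by positivity) (by positivity) hk, le_div_iff₀ hr] at hnle
    rwa [Real.rpow_neg (by positivity), ← div_eq_mul_inv, le_div_iff₀ (by positivity), mul_comm]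
  have hN : n ≤ Nfun a r := le_csSup (bddAbove_setOf_le hk hC' hr h') ⟨hn1, hmem⟩
  have hN' : (n : ℝ) ≤ Nfun a r := by exact_mod_cast hN
  have hlt : (C / r) ^ k⁻¹ < n + 1 := Nat.lt_floor_add_one _
  linarith

theorem two_mul_mul_Nfun_le_mfun {a : ℕ → ℝ} (hpos : ∀ j, 1 ≤ j → 0 < a j) (r : ℝ) :
    2 * r * (Nfun a r : ℝ) ≤ mfun a r := by
  have : 0 ≤ ∑' j : ℕ, if Nfun a r < j then a j else 0 := by
    refine tsum_nonneg fun j => ?_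
    split_ifs with hj
    · exact (hpos j (by omega)).le
    · exact le_rfl
  unfold mfun
  linarith

/-- A lower bound by a power less than `1` makes the reciprocal integrable near `0`. -/
theorem lintegral_one_div_ne_top_of_rpow_le {f : ℝ → ℝ} {s C r₀ : ℝ} (hs : s < 1) (hC : 0 < C)
    (hr₀ : 0 < r₀) (h : ∀ r : ℝ, 0 < r → r < r₀ → C * r ^ s ≤ f r) :
    ∫⁻ r in Set.Ioo (0 : ℝ) r₀, ENNReal.ofReal (1 / f r) ≠ ⊤ := by
  have hint : IntegrableOn (fun r : ℝ => C⁻¹ * r ^ (-s)) (Set.Ioo 0 r₀) :=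
    Integrable.const_mul ((intervalIntegral.integrableOn_Ioo_rpow_iff hr₀).2 (by linarith)) _
  refine ne_top_of_le_ne_top hint.lintegral_lt_top.ne
    (setLIntegral_mono' measurableSet_Ioo fun r hr => ENNReal.ofReal_le_ofReal ?_)
  have hpow : 0 < r ^ s := Real.rpow_pos_of_pos hr.1 _
  rw [Real.rpow_neg hr.1.le, ← mul_inv, ← one_div]
  exact one_div_le_one_div_of_le (by positivity) (h r hr.1 hr.2)

/-- If the edge lengths satisfy `a_j ≍ j^{-k}` for some `k > 1`, then
`m(r) ≥ C₃ r^{1 - 1/k}` near `0`, and consequently `∫_0 dr/m(r)` is finite. -/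
theorem stmt7 (a : ℕ → ℝ)
    (hpos : ∀ j, 1 ≤ j → 0 < a j)
    (hmono : ∀ j, 1 ≤ j → a (j+1) ≤ a j)
    (hsum : Summable fun j => a (j+1))
    (k : ℝ) (hk : 1 < k)
    (C₁ C₂ : ℝ) (hC₁ : 0 < C₁) (hC₁₂ : C₁ ≤ C₂)
    (hbound : ∀ j : ℕ, 1 ≤ j → C₁ * (j : ℝ) ^ (-k) ≤ a j ∧ a j ≤ C₂ * (j : ℝ) ^ (-k)) :
    ∃ C₃ : ℝ, 0 < C₃ ∧ ∃ r₀ : ℝ, 0 < r₀ ∧ r₀ < a 1 ∧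
      (∀ r : ℝ, 0 < r → r < r₀ → C₃ * r ^ (1 - 1/k) ≤ mfun a r) ∧
      ∫⁻ r in Set.Ioo (0:ℝ) r₀, ENNReal.ofReal (1 / mfun a r) ≠ ⊤ := by
  have hk0 : 0 < k := by linarith
  have ha1 : C₁ ≤ a 1 := by simpa using (hbound 1 le_rfl).1
  have hlow : ∀ r : ℝ, 0 < r → r < C₁ / 2 → C₁ ^ k⁻¹ * r ^ (1 - 1 / k) ≤ mfun a r := by
    intro r hr hrC
    have hN := rpow_le_two_mul_Nfun hk0 hC₁ (hC₁.trans_le hC₁₂) hr (by linarith)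
      (fun j hj => (hbound j hj).1) (fun j hj => (hbound j hj).2)
    calc C₁ ^ k⁻¹ * r ^ (1 - 1 / k) = r * (C₁ / r) ^ k⁻¹ := by
          rw [Real.div_rpow hC₁.le hr.le, Real.rpow_sub hr, Real.rpow_one, one_div]
          ring
      _ ≤ r * (2 * (Nfun a r : ℝ)) := mul_le_mul_of_nonneg_left hN hr.le
      _ = 2 * r * (Nfun a r : ℝ) := by ring
      _ ≤ mfun a r := two_mul_mul_Nfun_le_mfun hpos r
  have hC₃ : 0 < C₁ ^ k⁻¹ := Real.rpow_pos_of_pos hC₁ _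
  have hs : 1 - 1 / k < 1 := sub_lt_self _ (one_div_pos.2 hk0)
  exact ⟨C₁ ^ k⁻¹, hC₃, C₁ / 2, by linarith, by linarith, hlow,
    lintegral_one_div_ne_top_of_rpow_le hs hC₃ (by linarith) hlow⟩
end

section
/- For each integer n ≥ 3 there is a unique real number λ_n ∈ (√2, 2) satisfying λ_n^{n+2} − 2λ_n^{n+1} + 2λ_n − 1 = 0. Moreover λ_n > 3/2 for every n ≥ 3, the sequence (λ_n)_{n≥3} is strictly increasing, and λ_n → 2 as n → ∞. -/
/-- For `n ≥ 2` the polynomial `∑_{i=1}^{n} u^i - u^{n+1}` is strictly increasing on `[0, 1]`. -/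
theorem strictMonoOn_geom_sum_sub_pow {n : ℕ} (hn : 2 ≤ n) :
    StrictMonoOn (fun u : ℝ => ∑ i ∈ Finset.range n, u ^ (i + 1) - u ^ (n + 1))
      (Set.Icc 0 1) := by
  induction n, hn using Nat.le_induction with
  | base =>
    rintro u ⟨hu, hu'⟩ v ⟨hv, hv'⟩ huv
    simp only [Finset.sum_range_succ, Finset.sum_range_zero]
    have h : 0 < (v - u) * (1 + v + u - (v ^ 2 + u * v + u ^ 2)) := by
      apply mul_pos (by linarith)
      nlinarith [mul_nonneg hv (sub_nonneg.2 hv'), mul_nonneg hu (sub_nonneg.2 hv'),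
        mul_nonneg hu (sub_nonneg.2 hu')]
    norm_num only
    linarith
  | succ n _ ih =>
    rintro u ⟨hu, hu'⟩ v ⟨hv, hv'⟩ huv
    have h := ih ⟨hu, hu'⟩ ⟨hv, hv'⟩ huv
    simp only [Finset.sum_range_succ _ n] at h ⊢
    have h₂ : u ^ n * (u * (2 - u)) ≤ v ^ n * (v * (2 - v)) :=
      mul_le_mul (pow_le_pow_left₀ hu huv.le n) (by nlinarith)
        (mul_nonneg hu (by linarith)) (pow_nonneg hv n)
    linarith [show u ^ n * (u * (2 - u)) = 2 * u ^ (n + 1) - u ^ (n + 1 + 1) by ring,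
      show v ^ n * (v * (2 - v)) = 2 * v ^ (n + 1) - v ^ (n + 1 + 1) by ring]

theorem geom_sum_sub_pow_mul_one_sub (n : ℕ) (u : ℝ) :
    (∑ i ∈ Finset.range n, u ^ (i + 1) - u ^ (n + 1)) * (1 - u) =
      u - 2 * u ^ (n + 1) + u ^ (n + 2) := by
  induction n with
  | zero => simp; ring
  | succ n ih =>
    rw [Finset.sum_range_succ]
    linear_combination ih

theorem geom_sum_sub_pow_inv_eq_one {n : ℕ} {l : ℝ} (hl : 1 < l)
    (h : l ^ (n + 2) - 2 * l ^ (n + 1) + 2 * l - 1 = 0) :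
    ∑ i ∈ Finset.range n, l⁻¹ ^ (i + 1) - l⁻¹ ^ (n + 1) = 1 := by
  have hu : 1 - l⁻¹ ≠ 0 := (sub_pos.2 (inv_lt_one_of_one_lt₀ hl)).ne'
  apply mul_right_cancel₀ hu
  rw [geom_sum_sub_pow_mul_one_sub]
  have hl0 : l ≠ 0 := by positivity
  have h₁ : l * l⁻¹ = 1 := mul_inv_cancel₀ hl0
  have h₂ : l ^ (n + 1) * l⁻¹ ^ (n + 1) = 1 := by rw [← mul_pow, h₁, one_pow]
  linear_combination (-l⁻¹ ^ (n + 2)) * h + (l * l⁻¹ - 2 * l⁻¹) * h₂ +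
    (1 + 2 * l⁻¹ ^ (n + 1)) * h₁

theorem root_unique {n : ℕ} (hn : 2 ≤ n) {a b : ℝ} (ha : 1 < a) (hb : 1 < b)
    (hra : a ^ (n + 2) - 2 * a ^ (n + 1) + 2 * a - 1 = 0)
    (hrb : b ^ (n + 2) - 2 * b ^ (n + 1) + 2 * b - 1 = 0) : a = b := by
  refine inv_injective ((strictMonoOn_geom_sum_sub_pow hn).injOn
    ⟨by positivity, inv_le_one_of_one_le₀ ha.le⟩ ⟨by positivity, inv_le_one_of_one_le₀ hb.le⟩ ?_)
  exact (geom_sum_sub_pow_inv_eq_one ha hra).trans (geom_sum_sub_pow_inv_eq_one hb hrb).symm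

theorem exists_root_between {n : ℕ} {x : ℝ} (hx : x < 2)
    (h : x ^ (n + 2) - 2 * x ^ (n + 1) + 2 * x - 1 < 0) :
    ∃ l ∈ Set.Ioo x 2, l ^ (n + 2) - 2 * l ^ (n + 1) + 2 * l - 1 = 0 := by
  have hc : ContinuousOn (fun l : ℝ => l ^ (n + 2) - 2 * l ^ (n + 1) + 2 * l - 1)
      (Set.Icc x 2) := by fun_prop
  refine intermediate_value_Ioo hx.le hc ⟨h, ?_⟩
  have : (2 : ℝ) ^ (n + 2) = 2 * 2 ^ (n + 1) := by ring
  linarith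

theorem eval_three_halves_neg {n : ℕ} (hn : 3 ≤ n) :
    (3 / 2 : ℝ) ^ (n + 2) - 2 * (3 / 2) ^ (n + 1) + 2 * (3 / 2) - 1 < 0 := by
  have h : (3 / 2 : ℝ) ^ 4 ≤ (3 / 2) ^ (n + 1) :=
    pow_le_pow_right₀ (by norm_num) (by omega)
  rw [pow_succ _ (n + 1)]
  norm_num at h ⊢
  linarith

theorem root_gt_of_eval_neg {n : ℕ} (hn : 2 ≤ n) {x l : ℝ} (hx : 1 < x) (hx2 : x < 2)
    (h : x ^ (n + 2) - 2 * x ^ (n + 1) + 2 * x - 1 < 0) (hl : 1 < l)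
    (hr : l ^ (n + 2) - 2 * l ^ (n + 1) + 2 * l - 1 = 0) : x < l := by
  obtain ⟨y, hy, hry⟩ := exists_root_between hx2 h
  rw [root_unique hn hl (hx.trans hy.1) hr hry]
  exact hy.1

/-- For each `n ≥ 3` there is a unique `λ_n ∈ (√2, 2)` with
`λ_n^{n+2} − 2λ_n^{n+1} + 2λ_n − 1 = 0`; moreover `λ_n > 3/2` for all `n ≥ 3`,
the sequence `(λ_n)` is strictly increasing, and `λ_n → 2` as `n → ∞`. -/
theorem stmt9 :
    (∀ n : ℕ, 3 ≤ n → ∃! l : ℝ, l ∈ Set.Ioo (Real.sqrt 2) 2 ∧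
        l ^ (n + 2) - 2 * l ^ (n + 1) + 2 * l - 1 = 0) ∧
    (∀ lam : ℕ → ℝ,
      (∀ n : ℕ, 3 ≤ n → lam n ∈ Set.Ioo (Real.sqrt 2) 2 ∧
        lam n ^ (n + 2) - 2 * lam n ^ (n + 1) + 2 * lam n - 1 = 0) →
      (∀ n : ℕ, 3 ≤ n → 3 / 2 < lam n) ∧
      (∀ m n : ℕ, 3 ≤ m → m < n → lam m < lam n) ∧
      Filter.Tendsto lam Filter.atTop (nhds 2)) := by
  have one_lt_sqrt : 1 < Real.sqrt 2 := Real.lt_sqrt_of_sq_lt (by norm_num)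
  have sqrt_lt : Real.sqrt 2 < 3 / 2 := (Real.sqrt_lt' (by norm_num)).2 (by norm_num)
  refine ⟨fun n hn => ?_, fun lam hlam => ?_⟩
  · obtain ⟨l, hl, hr⟩ := exists_root_between (by norm_num) (eval_three_halves_neg hn)
    refine ⟨l, ⟨⟨sqrt_lt.trans hl.1, hl.2⟩, hr⟩, fun y hy => ?_⟩
    exact root_unique (by omega) (one_lt_sqrt.trans hy.1.1)
      (one_lt_sqrt.trans (sqrt_lt.trans hl.1)) hy.2 hr
  have one_lt : ∀ n, 3 ≤ n → 1 < lam n := fun n hn => one_lt_sqrt.trans (hlam n hn).1.1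
  have lower : ∀ n, 3 ≤ n → 3 / 2 < lam n := fun n hn =>
    root_gt_of_eval_neg (by omega) (by norm_num) (by norm_num) (eval_three_halves_neg hn)
      (one_lt n hn) (hlam n hn).2
  refine ⟨lower, fun m n hm hmn => ?_, ?_⟩
  · obtain ⟨⟨-, hlt⟩, hr⟩ := hlam m hm
    refine root_gt_of_eval_neg (by omega) (one_lt m hm) hlt ?_ (one_lt n (by omega))
      (hlam n (by omega)).2
    have hpow : lam m ^ (m + 1) < lam m ^ (n + 1) :=
      pow_lt_pow_right₀ (one_lt m hm) (by omega)
    rw [pow_succ _ (m + 1)] at hr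
    rw [pow_succ _ (n + 1)]
    nlinarith
  · have hlim : Filter.Tendsto (fun n : ℕ => 2 - 3 * (2 / 3 : ℝ) ^ n) Filter.atTop (nhds 2) := by
      simpa using ((tendsto_pow_atTop_nhds_zero_of_lt_one (r := (2 / 3 : ℝ)) (by norm_num)
        (by norm_num)).const_mul 3).const_sub 2
    refine tendsto_of_tendsto_of_tendsto_of_le_of_le' hlim tendsto_const_nhds ?_ ?_
    · filter_upwards [Filter.eventually_ge_atTop 3] with n hn
      obtain ⟨⟨-, hlt⟩, hr⟩ := hlam n hn
      have hpow : (3 / 2 : ℝ) ^ n ≤ lam n ^ (n + 1) :=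
        (pow_le_pow_left₀ (by norm_num) (lower n hn).le n).trans
          (pow_le_pow_right₀ (one_lt n hn).le n.le_succ)
      have hprod : (2 - lam n) * (3 / 2 : ℝ) ^ n ≤ 3 := by
        have := mul_le_mul_of_nonneg_left hpow (sub_nonneg.2 hlt.le)
        rw [pow_succ _ (n + 1)] at hr
        linarith
      have hinv : (3 / 2 : ℝ) ^ n * (2 / 3) ^ n = 1 := by
        rw [← mul_pow]; norm_num
      have := mul_le_mul_of_nonneg_right hprod (by positivity : (0 : ℝ) ≤ (2 / 3) ^ n)
      rw [mul_assoc, hinv] at this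
      linarith
    · filter_upwards [Filter.eventually_ge_atTop 3] with n hn
      exact (hlam n hn).1.2.le
end

section
/- Let n ≥ 3 be an integer and let λ ∈ (√2, 2) satisfy λ^{n+2} − 2λ^{n+1} + 2λ − 1 = 0. Define p_0 = 1, p_1 = 0, p_i = (2 − λ)(λ^{i−1} − 1)/(λ − 1) for 2 ≤ i ≤ n, and p_{n+1} = 1 − 1/λ. Then T_λ^i(1) = p_i for 0 ≤ i ≤ n+1, T_λ^{n+2}(1) = 1, and the points p_0, p_1, …, p_{n+1} are pairwise distinct; hence 1 is a periodic point of T_λ of least period n + 2. -/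
/-- The tent map `T_λ`. -/
noncomputable def tent (lam : ℝ) (x : ℝ) : ℝ :=
  if x ≤ 1 - 1 / lam then lam * (x - 1) + 2 else lam * (1 - x)

/-- The points `p_0 = 1`, `p_1 = 0`, `p_i = (2−λ)(λ^{i−1}−1)/(λ−1)` for `2 ≤ i ≤ n`,
`p_{n+1} = 1 − 1/λ`. -/
noncomputable def tentOrbit (n : ℕ) (lam : ℝ) (i : ℕ) : ℝ :=
  if i = 0 then 1
  else if i = 1 then 0
  else if i ≤ n then (2 - lam) * (lam ^ (i - 1) - 1) / (lam - 1)
  else 1 - 1 / lam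

/-- The orbit of `0` under the affine branch `x ↦ λ (x - 1) + 2`. -/
noncomputable def leftOrbit (lam : ℝ) (k : ℕ) : ℝ :=
  (2 - lam) * (lam ^ k - 1) / (lam - 1)

theorem leftOrbit_zero (lam : ℝ) : leftOrbit lam 0 = 0 := by
  simp [leftOrbit]

theorem leftOrbit_succ {lam : ℝ} (h1 : 1 < lam) (k : ℕ) :
    leftOrbit lam (k + 1) = lam * (leftOrbit lam k - 1) + 2 := by
  have : lam - 1 ≠ 0 := by linarith
  unfold leftOrbit
  field_simp
  ring

theorem leftOrbit_strictMono {lam : ℝ} (h1 : 1 < lam) (h2 : lam < 2) :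
    StrictMono (leftOrbit lam) := by
  intro a b hab
  have := pow_lt_pow_right₀ h1 hab
  unfold leftOrbit
  have h3 : 0 < lam - 1 := by linarith
  have h4 : 0 < 2 - lam := by linarith
  gcongr

theorem tentOrbit_zero (n : ℕ) (lam : ℝ) : tentOrbit n lam 0 = 1 := by
  simp [tentOrbit]

theorem tentOrbit_succ {n k : ℕ} (lam : ℝ) (hk : k < n) :
    tentOrbit n lam (k + 1) = leftOrbit lam k := by
  rcases Nat.eq_zero_or_pos k with rfl | h
  · simp [tentOrbit, leftOrbit]
  · have : k + 1 ≤ n := hk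
    simp [tentOrbit, leftOrbit, h.ne', this]

theorem tentOrbit_last {n : ℕ} (lam : ℝ) (hn : 1 ≤ n) :
    tentOrbit n lam (n + 1) = 1 - 1 / lam := by
  have : n ≠ 0 := by omega
  simp [tentOrbit, this]

theorem tent_one {lam : ℝ} (h1 : 1 < lam) : tent lam 1 = 0 := by
  have : 0 < 1 / lam := by positivity
  rw [tent, if_neg (by linarith)]
  ring

theorem tent_turning {lam : ℝ} (h1 : 1 < lam) : tent lam (1 - 1 / lam) = 1 := by
  rw [tent, if_pos le_rfl]
  field_simp
  ring

theorem leftOrbit_eq_of_root {m : ℕ} {lam : ℝ} (h1 : 1 < lam)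
    (heq : lam ^ (m + 3) - 2 * lam ^ (m + 2) + 2 * lam - 1 = 0) :
    leftOrbit lam m = 1 - (lam - 1) / lam ^ 2 := by
  have : lam - 1 ≠ 0 := by linarith
  have : lam ≠ 0 := by linarith
  unfold leftOrbit
  field_simp
  linear_combination -heq

theorem turning_lt_leftOrbit {m : ℕ} {lam : ℝ} (h1 : 1 < lam)
    (heq : lam ^ (m + 3) - 2 * lam ^ (m + 2) + 2 * lam - 1 = 0) :
    1 - 1 / lam < leftOrbit lam m := by
  rw [leftOrbit_eq_of_root h1 heq]
  have h0 : 0 < lam := by linarith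
  have : 1 / lam - (lam - 1) / lam ^ 2 = 1 / lam ^ 2 := by
    field_simp
    ring
  have : 0 < 1 / lam ^ 2 := by positivity
  linarith

theorem leftOrbit_lt_turning {m k : ℕ} {lam : ℝ} (h1 : 1 < lam) (h2 : lam < 2)
    (heq : lam ^ (m + 3) - 2 * lam ^ (m + 2) + 2 * lam - 1 = 0) (hk : k < m) :
    leftOrbit lam k < 1 - 1 / lam := by
  have h0 : 0 < lam := by linarith
  have hm := (leftOrbit_strictMono h1 h2).monotone (Nat.succ_le_of_lt hk)
  rw [Nat.succ_eq_add_one, leftOrbit_succ h1, leftOrbit_eq_of_root h1 heq] at hm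
  have h3 : 0 < (lam - 1) / lam ^ 2 := div_pos (by linarith) (by positivity)
  have h4 : lam * (1 - 1 / lam) = lam - 1 := by field_simp
  refine lt_of_mul_lt_mul_left ?_ h0.le
  linarith

theorem leftOrbit_lt_one {m k : ℕ} {lam : ℝ} (h1 : 1 < lam) (h2 : lam < 2)
    (heq : lam ^ (m + 3) - 2 * lam ^ (m + 2) + 2 * lam - 1 = 0) (hk : k ≤ m) :
    leftOrbit lam k < 1 := by
  have hm := (leftOrbit_strictMono h1 h2).monotone hk
  rw [leftOrbit_eq_of_root h1 heq] at hm
  have h3 : 0 < (lam - 1) / lam ^ 2 := div_pos (by linarith) (by positivity)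
  linarith

theorem tent_tentOrbit {m i : ℕ} {lam : ℝ} (h1 : 1 < lam) (h2 : lam < 2)
    (heq : lam ^ (m + 3) - 2 * lam ^ (m + 2) + 2 * lam - 1 = 0) (hi : i ≤ m + 1) :
    tent lam (tentOrbit (m + 1) lam i) = tentOrbit (m + 1) lam (i + 1) := by
  rcases i with _ | k
  · rw [tentOrbit_zero, tentOrbit_succ lam (Nat.succ_pos m), tent_one h1, leftOrbit_zero]
  rw [tentOrbit_succ lam (by omega)]
  rcases Nat.lt_or_ge k m with hk | hk
  · rw [tentOrbit_succ lam (by omega), leftOrbit_succ h1, tent,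
      if_pos (leftOrbit_lt_turning h1 h2 heq hk).le]
  · obtain rfl : k = m := by omega
    rw [tentOrbit_last lam (by omega), tent,
      if_neg (turning_lt_leftOrbit h1 heq).not_ge, leftOrbit_eq_of_root h1 heq]
    field_simp
    ring

theorem tentOrbit_ne_of_lt {m i j : ℕ} {lam : ℝ} (h1 : 1 < lam) (h2 : lam < 2)
    (heq : lam ^ (m + 3) - 2 * lam ^ (m + 2) + 2 * lam - 1 = 0) (hij : i < j)
    (hj : j ≤ m + 2) : tentOrbit (m + 1) lam i ≠ tentOrbit (m + 1) lam j := by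
  obtain ⟨l, rfl⟩ : ∃ l, j = l + 1 := ⟨j - 1, by omega⟩
  rcases Nat.lt_or_ge l (m + 1) with hl | hl
  · rw [tentOrbit_succ lam hl]
    rcases i with _ | k
    · rw [tentOrbit_zero]
      exact (leftOrbit_lt_one h1 h2 heq (by omega)).ne'
    · rw [tentOrbit_succ lam (by omega)]
      exact (leftOrbit_strictMono h1 h2 (by omega)).ne
  · obtain rfl : l = m + 1 := by omega
    rw [tentOrbit_last lam (by omega)]
    rcases i with _ | k
    · rw [tentOrbit_zero]
      have : 0 < 1 / lam := by positivity
      linarith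
    · rw [tentOrbit_succ lam (by omega)]
      rcases Nat.lt_or_ge k m with hk | hk
      · exact (leftOrbit_lt_turning h1 h2 heq hk).ne
      · obtain rfl : k = m := by omega
        exact (turning_lt_leftOrbit h1 heq).ne'

/-- For `n ≥ 3` and `λ ∈ (√2, 2)` with `λ^{n+2} − 2λ^{n+1} + 2λ − 1 = 0`, the orbit of
`1` under the tent map `T_λ` is `p_0, p_1, …, p_{n+1}`, returns to `1` after `n+2`
steps, and the points `p_0, …, p_{n+1}` are pairwise distinct; hence `1` is a periodic
point of `T_λ` of least period `n + 2`. -/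
theorem stmt11 (n : ℕ) (hn : 3 ≤ n) (lam : ℝ)
    (hlam : lam ∈ Set.Ioo (Real.sqrt 2) 2)
    (heq : lam ^ (n + 2) - 2 * lam ^ (n + 1) + 2 * lam - 1 = 0) :
    (∀ i ≤ n + 1, (tent lam)^[i] 1 = tentOrbit n lam i) ∧
    (tent lam)^[n + 2] 1 = 1 ∧
    (∀ i ≤ n + 1, ∀ j ≤ n + 1, i ≠ j → tentOrbit n lam i ≠ tentOrbit n lam j) ∧
    Function.IsPeriodicPt (tent lam) (n + 2) 1 ∧
    Function.minimalPeriod (tent lam) 1 = n + 2 := by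
  obtain ⟨hlam1, h2⟩ := hlam
  have h1 : 1 < lam := lt_of_le_of_lt (Real.one_le_sqrt.mpr one_le_two) hlam1
  obtain ⟨m, rfl⟩ : ∃ m, n = m + 1 := ⟨n - 1, by omega⟩
  have horbit : ∀ i ≤ m + 1 + 1, (tent lam)^[i] 1 = tentOrbit (m + 1) lam i := by
    intro i hi
    induction i with
    | zero => rw [tentOrbit_zero, Function.iterate_zero_apply]
    | succ k ih =>
      rw [Function.iterate_succ_apply', ih (by omega), tent_tentOrbit h1 h2 heq (by omega)]
  have hreturn : (tent lam)^[m + 1 + 2] 1 = 1 := by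
    rw [Function.iterate_succ_apply', horbit _ le_rfl, tentOrbit_last lam (by omega),
      tent_turning h1]
  have hdistinct : ∀ i ≤ m + 1 + 1, ∀ j ≤ m + 1 + 1, i ≠ j →
      tentOrbit (m + 1) lam i ≠ tentOrbit (m + 1) lam j := by
    intro i hi j hj hij
    rcases lt_or_gt_of_ne hij with h | h
    · exact tentOrbit_ne_of_lt h1 h2 heq h hj
    · exact (tentOrbit_ne_of_lt h1 h2 heq h hi).symm
  have hperiodic : Function.IsPeriodicPt (tent lam) (m + 1 + 2) 1 := hreturn
  refine ⟨horbit, hreturn, hdistinct, hperiodic, ?_⟩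
  refine le_antisymm (hperiodic.minimalPeriod_le (by omega)) (not_lt.mp fun hlt => ?_)
  have hpos := hperiodic.minimalPeriod_pos (by omega)
  have hle : Function.minimalPeriod (tent lam) 1 ≤ m + 1 + 1 := by omega
  apply hdistinct _ hle 0 (by omega) hpos.ne'
  rw [← horbit _ hle, Function.iterate_minimalPeriod, tentOrbit_zero]
end

section
/- Let n ≥ 3 be an integer and let λ ∈ (√2, 2) satisfy λ^{n+2} − 2λ^{n+1} + 2λ − 1 = 0. Then: (a) π_y(V_0 ∪ V_{n+1}) = [0,1] and π_y(V_0) ∩ π_y(V_{n+1}) consists of a single point; (b) π_y(V_1 ∪ V_2 ∪ ⋯ ∪ V_n) = [0,1], and for 1 ≤ i < j ≤ n the intersection π_y(V_i) ∩ π_y(V_j) consists of a single point if j = i + 1 and is empty otherwise. -/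
/-- The map `F_{n,λ} : ℝ² → ℝ²`. -/
noncomputable def Fmap (n : ℕ) (lam : ℝ) : ℝ × ℝ → ℝ × ℝ := fun p =>
  if p.1 ≤ 1 - 1 / lam then
    (lam * (p.1 - 1) + 2, p.2 / lam - 1 / (lam ^ (n + 1) + 1))
  else
    (lam * (1 - p.1), 1 - p.2 / lam)

/-- The vertical segments `V_i = F_{n,λ}^i(V_0)`, where
`V_0 = {1} × [0, λ^{n+1}/(λ^{n+1}+1)]`. -/
noncomputable def Vseg (n : ℕ) (lam : ℝ) (i : ℕ) : Set (ℝ × ℝ) :=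
  (Fmap n lam)^[i] '' (({1} : Set ℝ) ×ˢ Set.Icc (0:ℝ) (lam ^ (n + 1) / (lam ^ (n + 1) + 1)))

/-- The left branch of `Fmap` sends vertical segments to vertical segments, preserving
orientation. -/
theorem Fmap_image_of_le {n : ℕ} {lam x a b : ℝ} (hpos : 0 < lam) (hx : x ≤ 1 - 1 / lam) :
    Fmap n lam '' (({x} : Set ℝ) ×ˢ Set.Icc a b) =
      ({lam * (x - 1) + 2} : Set ℝ) ×ˢ
        Set.Icc (a / lam - 1 / (lam ^ (n + 1) + 1)) (b / lam - 1 / (lam ^ (n + 1) + 1)) := by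
  ext ⟨u, v⟩
  simp only [Set.mem_image, Set.mem_prod, Set.mem_singleton_iff, Set.mem_Icc, Prod.exists]
  constructor
  · rintro ⟨_, y, ⟨rfl, h1, h2⟩, h⟩
    simp only [Fmap, hx, if_true, Prod.mk.injEq] at h
    obtain ⟨rfl, rfl⟩ := h
    exact ⟨rfl, by gcongr, by gcongr⟩
  · rintro ⟨rfl, h1, h2⟩
    refine ⟨x, lam * (v + 1 / (lam ^ (n + 1) + 1)), ⟨rfl, ?_, ?_⟩, ?_⟩
    · rw [← div_le_iff₀' hpos]; linarith
    · rw [← le_div_iff₀' hpos]; linarith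
    · simp only [Fmap, hx, if_true, Prod.mk.injEq, true_and]
      rw [mul_div_cancel_left₀ _ hpos.ne']; ring

/-- The right branch of `Fmap` sends vertical segments to vertical segments, reversing
orientation. -/
theorem Fmap_image_of_lt {n : ℕ} {lam x a b : ℝ} (hpos : 0 < lam) (hx : 1 - 1 / lam < x) :
    Fmap n lam '' (({x} : Set ℝ) ×ˢ Set.Icc a b) =
      ({lam * (1 - x)} : Set ℝ) ×ˢ Set.Icc (1 - b / lam) (1 - a / lam) := by
  ext ⟨u, v⟩
  simp only [Set.mem_image, Set.mem_prod, Set.mem_singleton_iff, Set.mem_Icc, Prod.exists]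
  constructor
  · rintro ⟨_, y, ⟨rfl, h1, h2⟩, h⟩
    simp only [Fmap, hx.not_ge, if_false, Prod.mk.injEq] at h
    obtain ⟨rfl, rfl⟩ := h
    exact ⟨rfl, by gcongr, by gcongr⟩
  · rintro ⟨rfl, h1, h2⟩
    refine ⟨x, lam * (1 - v), ⟨rfl, ?_, ?_⟩, ?_⟩
    · rw [← div_le_iff₀' hpos]; linarith
    · rw [← le_div_iff₀' hpos]; linarith
    · simp only [Fmap, hx.not_ge, if_false, Prod.mk.injEq, true_and]
      rw [mul_div_cancel_left₀ _ hpos.ne']; ring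

theorem Vseg_succ (n : ℕ) (lam : ℝ) (i : ℕ) :
    Vseg n lam (i + 1) = Fmap n lam '' Vseg n lam i := by
  simp only [Vseg, Function.iterate_succ', Set.image_comp]

/-- The ordinate of the common endpoint of `V_k` and `V_{k+1}`. -/
noncomputable def breakpoint (lam : ℝ) (k : ℕ) : ℝ :=
  ((2 * lam - 1) / lam ^ k - (2 - lam) * lam) / (lam ^ 2 - 1)

theorem breakpoint_strictAnti {lam : ℝ} (h1 : 1 < lam) : StrictAnti (breakpoint lam) := by
  intro i j hij
  have h2 : 0 < lam ^ 2 - 1 := by nlinarith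
  have h3 : lam ^ i < lam ^ j := pow_lt_pow_right₀ h1 hij
  have h4 : 0 < lam ^ i := by positivity
  unfold breakpoint
  have h5 : 0 < 2 * lam - 1 := by linarith
  gcongr

theorem breakpoint_zero {lam : ℝ} (h1 : 1 < lam) : breakpoint lam 0 = 1 := by
  have h2 : lam ^ 2 - 1 ≠ 0 := by nlinarith
  unfold breakpoint
  rw [div_eq_one_iff_eq h2]
  ring

section Root

variable {n : ℕ} {lam : ℝ}

theorem breakpoint_of_root (h1 : 1 < lam)
    (heq : lam ^ (n + 2) - 2 * lam ^ (n + 1) + 2 * lam - 1 = 0) :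
    breakpoint lam n = 0 := by
  have h3 : (2 * lam - 1) / lam ^ n = (2 - lam) * lam := by
    rw [div_eq_iff (by positivity)]
    linear_combination heq
  simp [breakpoint, h3]

theorem inv_pow_add_one_of_root (h1 : 1 < lam)
    (heq : lam ^ (n + 2) - 2 * lam ^ (n + 1) + 2 * lam - 1 = 0) :
    1 / (lam ^ (n + 1) + 1) = (2 - lam) / (lam + 1) := by
  have : lam ^ (n + 1) + 1 ≠ 0 := by positivity
  rw [div_eq_div_iff this (by linarith)]
  linear_combination heq

theorem height_of_root (h1 : 1 < lam)
    (heq : lam ^ (n + 2) - 2 * lam ^ (n + 1) + 2 * lam - 1 = 0) :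
    lam ^ (n + 1) / (lam ^ (n + 1) + 1) = (2 * lam - 1) / (lam + 1) := by
  have : lam ^ (n + 1) + 1 ≠ 0 := by positivity
  rw [div_eq_div_iff this (by linarith)]
  linear_combination -heq

theorem breakpoint_succ (h1 : 1 < lam) (k : ℕ) :
    breakpoint lam k / lam - (2 - lam) / (lam + 1) = breakpoint lam (k + 1) := by
  have h3 : lam ^ 2 - 1 ≠ 0 := by nlinarith
  have h4 : lam + 1 ≠ 0 := by linarith
  have h5 : lam - 1 ≠ 0 := by linarith
  have h6 : lam ≠ 0 := by linarith
  have h7 : lam ^ 2 - 1 = (lam + 1) * (lam - 1) := by ring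
  unfold breakpoint
  rw [h7, pow_succ]
  field_simp
  ring

theorem Vseg_zero_of_root (h1 : 1 < lam)
    (heq : lam ^ (n + 2) - 2 * lam ^ (n + 1) + 2 * lam - 1 = 0) :
    Vseg n lam 0 = ({1} : Set ℝ) ×ˢ Set.Icc 0 ((2 * lam - 1) / (lam + 1)) := by
  simp only [Vseg, Function.iterate_zero, Set.image_id, height_of_root h1 heq]

theorem Vseg_succ_of_root (h1 : 1 < lam) (h2 : lam < 2)
    (heq : lam ^ (n + 2) - 2 * lam ^ (n + 1) + 2 * lam - 1 = 0) {k : ℕ} (hk : k < n) :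
    Vseg n lam (k + 1) = ({(2 - lam) * (lam ^ k - 1) / (lam - 1)} : Set ℝ) ×ˢ
      Set.Icc (breakpoint lam (k + 1)) (breakpoint lam k) := by
  have hpos : 0 < lam := by linarith
  have h5 : lam - 1 ≠ 0 := by linarith
  induction k with
  | zero =>
    rw [Vseg_succ, Vseg_zero_of_root h1 heq,
      Fmap_image_of_lt hpos (by have := one_div_pos.mpr hpos; linarith),
      ← breakpoint_succ h1, breakpoint_zero h1]
    have : 1 - (2 * lam - 1) / (lam + 1) / lam = 1 / lam - (2 - lam) / (lam + 1) := by
      field_simp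
      ring
    simp [this]
  | succ k ih =>
    have hx : (2 - lam) * (lam ^ k - 1) / (lam - 1) ≤ 1 - 1 / lam := by
      have hp : lam ^ (k + 3) ≤ lam ^ (n + 1) := pow_le_pow_right₀ h1.le (by omega)
      have hq : (2 - lam) * lam ^ (k + 3) ≤ 2 * lam - 1 := by
        have := mul_le_mul_of_nonneg_left hp (by linarith : (0 : ℝ) ≤ 2 - lam)
        linear_combination this - heq
      have hr : (2 - lam) * lam ^ (k + 1) ≤ 1 := by
        have : (2 - lam) * lam ^ (k + 1) * lam ^ 2 ≤ 1 * lam ^ 2 := by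
          linear_combination hq + sq_nonneg (lam - 1)
        exact le_of_mul_le_mul_right this (by positivity)
      rw [div_le_iff₀ (by linarith), one_sub_div hpos.ne', div_mul_eq_mul_div,
        le_div_iff₀ hpos]
      linear_combination hr
    rw [Vseg_succ, ih (by omega), Fmap_image_of_le hpos hx,
      inv_pow_add_one_of_root h1 heq, breakpoint_succ h1, breakpoint_succ h1]
    congr 2
    field_simp
    ring

theorem snd_image_Vseg_zero (h1 : 1 < lam)
    (heq : lam ^ (n + 2) - 2 * lam ^ (n + 1) + 2 * lam - 1 = 0) :
    Prod.snd '' Vseg n lam 0 = Set.Icc 0 ((2 * lam - 1) / (lam + 1)) := by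
  rw [Vseg_zero_of_root h1 heq, Set.snd_image_prod (Set.singleton_nonempty _)]

theorem snd_image_Vseg_succ (h1 : 1 < lam) (h2 : lam < 2)
    (heq : lam ^ (n + 2) - 2 * lam ^ (n + 1) + 2 * lam - 1 = 0) {k : ℕ} (hk : k < n) :
    Prod.snd '' Vseg n lam (k + 1) = Set.Icc (breakpoint lam (k + 1)) (breakpoint lam k) := by
  rw [Vseg_succ_of_root h1 h2 heq hk, Set.snd_image_prod (Set.singleton_nonempty _)]

theorem snd_image_Vseg_last (hn : n ≠ 0) (h1 : 1 < lam) (h2 : lam < 2)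
    (heq : lam ^ (n + 2) - 2 * lam ^ (n + 1) + 2 * lam - 1 = 0) :
    Prod.snd '' Vseg n lam (n + 1) = Set.Icc ((2 * lam - 1) / (lam + 1)) 1 := by
  obtain ⟨m, rfl⟩ := Nat.exists_eq_add_one_of_ne_zero hn
  have hpos : 0 < lam := by linarith
  have hx : 1 - 1 / lam < (2 - lam) * (lam ^ m - 1) / (lam - 1) := by
    have hr : 1 < (2 - lam) * lam ^ (m + 1) := by
      have : 1 * lam < (2 - lam) * lam ^ (m + 1) * lam := by
        linear_combination h1 + heq
      exact lt_of_mul_lt_mul_right this hpos.le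
    rw [lt_div_iff₀ (by linarith), one_sub_div hpos.ne', div_mul_eq_mul_div,
      div_lt_iff₀ hpos]
    linear_combination hr
  have hb : 1 - breakpoint lam m / lam = (2 * lam - 1) / (lam + 1) := by
    have := breakpoint_succ h1 m
    rw [breakpoint_of_root h1 heq] at this
    have h4 : lam + 1 ≠ 0 := by linarith
    rw [sub_eq_zero.mp this]
    field_simp
    ring
  rw [Vseg_succ, Vseg_succ_of_root h1 h2 heq (Nat.lt_succ_self m), Fmap_image_of_lt hpos hx,
    Set.snd_image_prod (Set.singleton_nonempty _), hb, breakpoint_of_root h1 heq]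
  simp

end Root

/-- Adjacent closed intervals cut out by an antitone sequence glue to a closed interval. -/
theorem Antitone.iUnion_Icc_succ {e : ℕ → ℝ} (he : Antitone e) {n : ℕ} (hn : n ≠ 0) :
    ⋃ k ∈ Finset.range n, Set.Icc (e (k + 1)) (e k) = Set.Icc (e n) (e 0) := by
  induction n with
  | zero => exact absurd rfl hn
  | succ n ih =>
    rcases eq_or_ne n 0 with rfl | h
    · simp
    · rw [Finset.range_add_one, Finset.set_biUnion_insert, ih h,
        Set.Icc_union_Icc_eq_Icc (he n.le_succ) (he n.zero_le)]

/-- Configuration of the vertical sides of the NBT polygon: (a) the projections to the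
second coordinate of `V_0` and `V_{n+1}` cover `[0,1]` and overlap in a single point;
(b) the projections of `V_1, …, V_n` cover `[0,1]`, consecutive ones overlap in a
single point, and non-consecutive ones are disjoint. -/
theorem stmt12 (n : ℕ) (hn : 3 ≤ n) (lam : ℝ)
    (hlam : lam ∈ Set.Ioo (Real.sqrt 2) 2)
    (heq : lam ^ (n + 2) - 2 * lam ^ (n + 1) + 2 * lam - 1 = 0) :
    (Prod.snd '' (Vseg n lam 0 ∪ Vseg n lam (n + 1)) = Set.Icc (0:ℝ) 1 ∧
      ∃ y : ℝ, Prod.snd '' Vseg n lam 0 ∩ Prod.snd '' Vseg n lam (n + 1) = {y}) ∧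
    (Prod.snd '' (⋃ i ∈ Finset.Icc 1 n, Vseg n lam i) = Set.Icc (0:ℝ) 1 ∧
      ∀ i j : ℕ, 1 ≤ i → i < j → j ≤ n →
        (j = i + 1 → ∃ y : ℝ, Prod.snd '' Vseg n lam i ∩ Prod.snd '' Vseg n lam j = {y}) ∧
        (j ≠ i + 1 → Prod.snd '' Vseg n lam i ∩ Prod.snd '' Vseg n lam j = ∅)) := by
  obtain ⟨hl, h2⟩ := hlam
  have h1 : 1 < lam := lt_trans (by rw [Real.lt_sqrt] <;> norm_num) hl
  have hn0 : n ≠ 0 := by omega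
  have hanti := breakpoint_strictAnti h1
  have hh0 : 0 ≤ (2 * lam - 1) / (lam + 1) := div_nonneg (by linarith) (by linarith)
  have hh1 : (2 * lam - 1) / (lam + 1) ≤ 1 := by
    rw [div_le_one (by linarith)]; linarith
  refine ⟨⟨?_, ?_⟩, ?_, ?_⟩
  · rw [Set.image_union, snd_image_Vseg_zero h1 heq, snd_image_Vseg_last hn0 h1 h2 heq,
      Set.Icc_union_Icc_eq_Icc hh0 hh1]
  · rw [snd_image_Vseg_zero h1 heq, snd_image_Vseg_last hn0 h1 h2 heq]
    exact ⟨_, Set.Icc_inter_Icc_eq_singleton hh0 hh1⟩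
  · rw [← breakpoint_of_root h1 heq, ← breakpoint_zero h1,
      ← hanti.antitone.iUnion_Icc_succ hn0, Set.image_iUnion₂]
    ext y
    simp only [Set.mem_iUnion, Finset.mem_Icc, Finset.mem_range, exists_prop]
    constructor
    · rintro ⟨i, ⟨hi, hin⟩, hy⟩
      obtain ⟨k, rfl⟩ := Nat.exists_eq_add_of_le' hi
      exact ⟨k, hin, by rwa [snd_image_Vseg_succ h1 h2 heq hin] at hy⟩
    · rintro ⟨k, hk, hy⟩
      exact ⟨k + 1, ⟨by omega, hk⟩, by rwa [snd_image_Vseg_succ h1 h2 heq hk]⟩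
  · intro i j hi hij hj
    obtain ⟨k, rfl⟩ := Nat.exists_eq_add_of_le' hi
    obtain ⟨l, rfl⟩ := Nat.exists_eq_add_of_le' (hi.trans hij.le)
    rw [snd_image_Vseg_succ h1 h2 heq (by omega), snd_image_Vseg_succ h1 h2 heq (by omega),
      Set.inter_comm]
    constructor
    · intro h
      obtain rfl : l = k + 1 := by omega
      exact ⟨_, Set.Icc_inter_Icc_eq_singleton (hanti.antitone (Nat.le_succ _))
        (hanti.antitone (Nat.le_succ _))⟩
    · intro h
      have hlt : breakpoint lam l < breakpoint lam (k + 1) := hanti (by omega)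
      refine Set.eq_empty_of_forall_notMem fun y hy => ?_
      exact absurd (hy.2.1.trans hy.1.2) (not_le.mpr hlt)
end

section
/- Let n ≥ 3 be an integer and let λ ∈ (√2, 2) satisfy λ^{n+2} − 2λ^{n+1} + 2λ − 1 = 0. Then F_{n,λ}(1 − 1/λ, 1 − h/(2λ^{n+1})) = (1, h/2); that is, F_{n,λ} maps the midpoint of the vertical segment V_{n+1} = {1 − 1/λ} × [1 − h/λ^{n+1}, 1] to the midpoint of V_0 = {1} × [0, h]. Equivalently, (1 − h/(2λ^{n+1}))/λ − 1/(λ^{n+1}+1) = h/2. -/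
/-- `F_{n,λ}` maps the midpoint of the vertical segment
`V_{n+1} = {1 − 1/λ} × [1 − h/λ^{n+1}, 1]` to the midpoint of `V_0 = {1} × [0, h]`,
where `h = λ^{n+1}/(λ^{n+1}+1)`; equivalently
`(1 − h/(2λ^{n+1}))/λ − 1/(λ^{n+1}+1) = h/2`. -/
theorem stmt13 (n : ℕ) (hn : 3 ≤ n) (lam : ℝ)
    (hlam : lam ∈ Set.Ioo (Real.sqrt 2) 2)
    (heq : lam ^ (n + 2) - 2 * lam ^ (n + 1) + 2 * lam - 1 = 0)
    (h : ℝ) (hh : h = lam ^ (n + 1) / (lam ^ (n + 1) + 1)) :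
    Fmap n lam (1 - 1 / lam, 1 - h / (2 * lam ^ (n + 1))) = (1, h / 2) ∧
    (1 - h / (2 * lam ^ (n + 1))) / lam - 1 / (lam ^ (n + 1) + 1) = h / 2 := by
  have hpos : 0 < lam := (Real.sqrt_nonneg 2).trans_lt hlam.1
  have hmid : (1 - h / (2 * lam ^ (n + 1))) / lam - 1 / (lam ^ (n + 1) + 1) = h / 2 := by
    rw [pow_succ lam (n + 1)] at heq
    have hP : 0 < lam ^ (n + 1) := pow_pos hpos _
    subst hh
    generalize lam ^ (n + 1) = P at heq hP ⊢
    have hP1 : P + 1 ≠ 0 := by positivity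
    field_simp
    linear_combination -heq
  refine ⟨?_, hmid⟩
  rw [Fmap, if_pos le_rfl]
  refine Prod.ext ?_ hmid
  field_simp
  ring
end

section
/- Let n ≥ 3 be an integer and let λ ∈ (√2, 2) satisfy λ^{n+2} − 2λ^{n+1} + 2λ − 1 = 0. Set L = λ^{n−1}(λ−1)/(λ^n − 1) and M = L/λ^{n−1}. Then: (i) λL = (λ − 1) + M; (ii) 1 − 1/λ + L = 1 − (2 − λ)/(λ(λ + 1)); and (iii) L = (1 − 1/λ) + ((2 − λ) − M). (These identities locate the period-n orbit point q_0 on the boundary of the NBT polygon and verify that the horizontal boundary identifications match up.) -/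
/-- Identities locating the period-`n` orbit point `q_0` on the boundary of the NBT
polygon: with `L = λ^{n−1}(λ−1)/(λ^n − 1)` and `M = L/λ^{n−1}`, one has
(i) `λL = (λ−1) + M`; (ii) `1 − 1/λ + L = 1 − (2−λ)/(λ(λ+1))`; and
(iii) `L = (1 − 1/λ) + ((2−λ) − M)`. -/
theorem stmt14 (n : ℕ) (hn : 3 ≤ n) (lam : ℝ)
    (hlam : lam ∈ Set.Ioo (Real.sqrt 2) 2)
    (heq : lam ^ (n + 2) - 2 * lam ^ (n + 1) + 2 * lam - 1 = 0)
    (L M : ℝ)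
    (hL : L = lam ^ (n - 1) * (lam - 1) / (lam ^ n - 1))
    (hM : M = L / lam ^ (n - 1)) :
    lam * L = (lam - 1) + M ∧
    1 - 1 / lam + L = 1 - (2 - lam) / (lam * (lam + 1)) ∧
    L = (1 - 1 / lam) + ((2 - lam) - M) := by
  obtain ⟨k, rfl⟩ : ∃ k, n = k + 1 := ⟨n - 1, by omega⟩
  have hlam1 : 1 < lam :=
    lt_of_le_of_lt (Real.one_le_sqrt.mpr (by norm_num)) hlam.1
  have hlam0 : lam ≠ 0 := by positivity
  have hlam2 : lam + 1 ≠ 0 := by positivity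
  have hpow : lam ^ k ≠ 0 := pow_ne_zero _ hlam0
  have hden : lam ^ (k + 1) - 1 ≠ 0 := (sub_pos.mpr (one_lt_pow₀ hlam1 (by omega))).ne'
  rw [Nat.add_sub_cancel] at hL hM
  have hL_mul : L * (lam ^ (k + 1) - 1) = lam ^ k * (lam - 1) := by
    rw [hL, div_mul_cancel₀ _ hden]
  have hM_mul : M * (lam ^ (k + 1) - 1) = lam - 1 := by
    rw [hM, hL]
    field_simp
  have hi : lam * L = (lam - 1) + M := by
    apply mul_right_cancel₀ hden
    linear_combination lam * hL_mul - hM_mul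
  have hL_eq : L * (lam * (lam + 1)) = 2 * lam - 1 := by
    apply mul_right_cancel₀ hden
    linear_combination lam * (lam + 1) * hL_mul + heq
  refine ⟨hi, ?_, ?_⟩
  · field_simp
    linear_combination hL_eq
  · field_simp
    linear_combination hL_eq - lam * hi
end

section
/- Let n ≥ 3 be an integer, let λ ∈ (√2, 2), and set α = (λ − 1)/(λ^n − 1), β = (λ − 1)/(λ^{n+2} − 1), and ℓ_i = α λ^i + β λ^{n−1−i} for 0 ≤ i ≤ n − 3. Then for every r ∈ (0, 1/24): (a) 4 + #{ i ∈ {0, …, n−3} : ℓ_i ≥ r } ≤ 4·log₂(4/r); and (b) 8r + 2·∑_{i=0}^{n−3} min(ℓ_i, r) ≤ 8·r·log₂(8/r). (The left-hand sides of (a) and (b) are upper bounds for, respectively, the number n(q_0;r) of points at distance exactly r from the central vertex q_0 of the scar G_n of the 1/n NBT paper-folding scheme, and the measure m(q_0;r) of the ball of radius r about q_0; ℓ_i are the edge lengths of the star at q_0.) -/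
open Finset in
theorem sum_min_geometric_le {q c r : ℝ} (hq0 : 0 ≤ q) (hq1 : q < 1) (hc : 0 ≤ c) {K : ℕ}
    (hK : c * q ^ K ≤ r) (N : ℕ) :
    ∑ i ∈ range N, min (c * q ^ i) r ≤ K * r + r / (1 - q) := by
  have hr : 0 ≤ r := le_trans (by positivity) hK
  have hnn : ∀ i, 0 ≤ min (c * q ^ i) r := fun i => le_min (by positivity) hr
  have hgeom : ∑ i ∈ range N, q ^ i ≤ 1 / (1 - q) := by
    rw [le_div_iff₀ (by linarith), geom_sum_mul_neg]
    have := pow_nonneg hq0 N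
    linarith
  calc ∑ i ∈ range N, min (c * q ^ i) r
      ≤ ∑ i ∈ range (K + N), min (c * q ^ i) r :=
        sum_le_sum_of_subset_of_nonneg (range_subset_range.2 (by omega)) fun i _ _ => hnn i
    _ = ∑ i ∈ range K, min (c * q ^ i) r + ∑ i ∈ range N, min (c * q ^ (K + i)) r :=
        sum_range_add _ _ _
    _ ≤ ∑ _i ∈ range K, r + ∑ i ∈ range N, r * q ^ i := by
        gcongr with i _ i _
        · exact min_le_right _ _
        · refine (min_le_left _ _).trans ?_
          rw [pow_add, ← mul_assoc]
          gcongr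
    _ ≤ K * r + r / (1 - q) := by
        rw [sum_const, card_range, nsmul_eq_mul, ← mul_sum, div_eq_mul_one_div r]
        gcongr

theorem mul_pow_le_mul_pow_of_mem_Ioo {x : ℝ} (hx : x ∈ Set.Ioo (Real.sqrt 2) 2) {m i j : ℕ}
    (h : m = 3 + j + i) :
    (x - 1) / (x ^ m - 1) * x ^ i ≤ 5 / 12 * (1 / Real.sqrt 2) ^ j := by
  obtain ⟨h1, h2⟩ := hx
  have hs : (1.414 : ℝ) < Real.sqrt 2 := Real.lt_sqrt_of_sq_lt (by norm_num)
  have hs2 : Real.sqrt 2 ^ 2 = 2 := Real.sq_sqrt (by norm_num)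
  have hx1 : (1.414 : ℝ) < x := hs.trans h1
  have hm : x ^ 3 ≤ x ^ m := pow_le_pow_right₀ (by linarith) (by omega)
  have hcube : x ^ 3 * (15 - 7 * x) ≥ 8 := by
    have : 0 ≤ (2 - x) * (7 * x ^ 3 - x ^ 2 - 2 * x - 4) :=
      mul_nonneg (by linarith) (by nlinarith [mul_pos (sub_pos.2 hx1) (sub_pos.2 hx1)])
    nlinarith
  have hx3 : 1 < x ^ 3 := one_lt_pow₀ (by linarith) (by norm_num)
  have hC : (x - 1) / (x ^ m - 1) ≤ 8 / 7 / x ^ m := by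
    rw [div_le_div_iff₀ (by linarith) (by linarith)]
    nlinarith [mul_le_mul_of_nonneg_right hm (by linarith : 0 ≤ 15 - 7 * x)]
  have hpow : Real.sqrt 2 ^ j ≤ x ^ j := pow_le_pow_left₀ (by linarith) h1.le j
  have hx3' : 2.8 ≤ x ^ 3 := by
    have : Real.sqrt 2 ^ 3 ≤ x ^ 3 := pow_le_pow_left₀ (by linarith) h1.le 3
    nlinarith
  have hsj : 0 < Real.sqrt 2 ^ j := by positivity
  calc (x - 1) / (x ^ m - 1) * x ^ i ≤ 8 / 7 / x ^ m * x ^ i := by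
        have : 0 ≤ x ^ i := pow_nonneg (by linarith) i
        gcongr
    _ = 8 / 7 / (x ^ 3 * x ^ j) := by
        have : x ≠ 0 := by linarith
        rw [h, pow_add, pow_add]
        field_simp
    _ ≤ 8 / 7 / (2.8 * Real.sqrt 2 ^ j) := by gcongr
    _ ≤ 5 / 12 * (1 / Real.sqrt 2) ^ j := by
        rw [one_div_pow, div_mul_eq_div_div, mul_one_div]
        exact div_le_div_of_nonneg_right (by norm_num) hsj.le

theorem exists_nat_le_logb_and_geometric_lt {r : ℝ} (hr : 0 < r) (hr' : r < 1 / 24) :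
    ∃ K : ℕ, (K : ℝ) ≤ 2 * Real.logb 2 (1 / r) + 1 / 2 ∧
      5 / 6 * (1 / Real.sqrt 2) ^ K < r := by
  set M := Real.logb 2 (1 / r) with hM
  have hM4 : 4 ≤ M := by
    rw [hM, Real.le_logb_iff_rpow_le (by norm_num) (by positivity), le_div_iff₀ hr]
    norm_num
    linarith
  refine ⟨⌊2 * M - 1 / 2⌋₊ + 1, ?_, ?_⟩
  · have := Nat.floor_le (by linarith : 0 ≤ 2 * M - 1 / 2)
    push_cast
    linarith
  · have hK := Nat.lt_floor_add_one (2 * M - 1 / 2)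
    set K := ⌊2 * M - 1 / 2⌋₊ + 1 with hKdef
    have hK' : 2 * M - 1 / 2 < K := by rw [hKdef]; push_cast; exact hK
    have hr2 : (2 : ℝ) ^ (4 * M) = (1 / r) ^ 4 := by
      rw [mul_comm, Real.rpow_mul (by norm_num), hM,
        Real.rpow_logb (by norm_num) (by norm_num) (by positivity)]
      norm_cast
    have hlt : (1 / r) ^ 4 < 2 * (2 : ℝ) ^ (2 * K) := by
      rw [← hr2, ← pow_succ', ← Real.rpow_natCast]
      apply Real.rpow_lt_rpow_of_exponent_lt (by norm_num)
      push_cast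
      linarith
    have hs4 : ((1 / Real.sqrt 2) ^ K) ^ 4 = 1 / (2 : ℝ) ^ (2 * K) := by
      rw [← pow_mul, one_div_pow, show K * 4 = 2 * (2 * K) by ring, pow_mul,
        Real.sq_sqrt (by norm_num)]
    refine lt_of_pow_lt_pow_left₀ 4 hr.le ?_
    rw [mul_pow, hs4]
    rw [one_div_pow, div_lt_iff₀ (by positivity)] at hlt
    rw [mul_one_div, div_lt_iff₀ (by positivity)]
    norm_num
    nlinarith

/-- Bounds on the number `n(q₀;r)` of points at distance exactly `r` from the central
vertex `q₀` of the scar `G_n` of the `1/n` NBT paper-folding scheme, and on the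
measure `m(q₀;r)` of the ball of radius `r` about `q₀`, where
`ℓ_i = αλ^i + βλ^{n−1−i}` (for `0 ≤ i ≤ n−3`) are the edge lengths of the star at
`q₀`, `α = (λ−1)/(λ^n−1)` and `β = (λ−1)/(λ^{n+2}−1)`. -/
theorem stmt15 (n : ℕ) (hn : 3 ≤ n) (lam : ℝ)
    (hlam : lam ∈ Set.Ioo (Real.sqrt 2) 2)
    (α β : ℝ)
    (hα : α = (lam - 1) / (lam ^ n - 1))
    (hβ : β = (lam - 1) / (lam ^ (n + 2) - 1))
    (ℓ : ℕ → ℝ) (hℓ : ∀ i < n - 2, ℓ i = α * lam ^ i + β * lam ^ (n - 1 - i)) :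
    ∀ r : ℝ, 0 < r → r < 1 / 24 →
      ((4 : ℝ) + ((Finset.range (n - 2)).filter (fun i => r ≤ ℓ i)).card ≤
        4 * Real.logb 2 (4 / r)) ∧
      (8 * r + 2 * ∑ i ∈ Finset.range (n - 2), min (ℓ i) r ≤
        8 * r * Real.logb 2 (8 / r)) := by
  intro r hr hr'
  obtain ⟨K, hK, hKr⟩ := exists_nat_le_logb_and_geometric_lt hr hr'
  have hq0 : 0 ≤ 1 / Real.sqrt 2 := by positivity
  have hs : (1.414 : ℝ) < Real.sqrt 2 := Real.lt_sqrt_of_sq_lt (by norm_num)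
  have hq1 : 1 / Real.sqrt 2 < 1 := by
    rw [div_lt_one (by linarith)]
    linarith
  have hlog : ∀ k : ℕ, Real.logb 2 (2 ^ k / r) = k + Real.logb 2 (1 / r) := fun k => by
    rw [div_eq_mul_one_div, Real.logb_mul (by positivity) (by positivity), Real.logb_pow,
      Real.logb_self_eq_one (by norm_num), mul_one]
  have hlog4 : Real.logb 2 (4 / r) = 2 + Real.logb 2 (1 / r) := by
    have := hlog 2
    norm_num at this ⊢
    exact this
  have hlog8 : Real.logb 2 (8 / r) = 3 + Real.logb 2 (1 / r) := by
    have := hlog 3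
    norm_num at this ⊢
    exact this
  have hle : ∀ i < n - 2, ℓ i ≤ 5 / 12 * (1 / Real.sqrt 2) ^ i +
      5 / 12 * (1 / Real.sqrt 2) ^ (n - 2 - 1 - i) := fun i hi => by
    rw [hℓ i hi, hα, hβ, add_comm]
    exact add_le_add (mul_pow_le_mul_pow_of_mem_Ioo hlam (by omega))
      (mul_pow_le_mul_pow_of_mem_Ioo hlam (by omega))
  have hor : ∀ i < n - 2, ℓ i ≤ 5 / 6 * (1 / Real.sqrt 2) ^ i ∨
      ℓ i ≤ 5 / 6 * (1 / Real.sqrt 2) ^ (n - 2 - 1 - i) := fun i hi => by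
    by_contra! h
    linarith [hle i hi]
  constructor
  · have hlt : ∀ k : ℕ, r ≤ 5 / 6 * (1 / Real.sqrt 2) ^ k → k < K := fun k hk => by
      by_contra! h
      have := pow_le_pow_of_le_one hq0 hq1.le h
      linarith
    have hsub : (Finset.range (n - 2)).filter (fun i => r ≤ ℓ i) ⊆
        Finset.range K ∪ (Finset.range K).image (fun k => n - 2 - 1 - k) := by
      intro i hi
      simp only [Finset.mem_filter, Finset.mem_range, Finset.mem_union, Finset.mem_image] at hi ⊢
      rcases hor i hi.1 with h | h
      · exact Or.inl (hlt _ (hi.2.trans h))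
      · exact Or.inr ⟨n - 2 - 1 - i, hlt _ (hi.2.trans h), by omega⟩
    have hcard : ((Finset.range (n - 2)).filter (fun i => r ≤ ℓ i)).card ≤ K + K := by
      refine (Finset.card_le_card hsub).trans ((Finset.card_union_le _ _).trans ?_)
      have := Finset.card_image_le (s := Finset.range K) (f := fun k => n - 2 - 1 - k)
      simp only [Finset.card_range] at this ⊢
      omega
    have hcard' : (((Finset.range (n - 2)).filter (fun i => r ≤ ℓ i)).card : ℝ) ≤ K + K := by
      exact_mod_cast hcard
    rw [hlog4]
    linarith
  · set g : ℕ → ℝ := fun i => min (5 / 6 * (1 / Real.sqrt 2) ^ i) r with hg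
    have hg0 : ∀ i, 0 ≤ g i := fun i => le_min (by positivity) hr.le
    have hsum : ∑ i ∈ Finset.range (n - 2), min (ℓ i) r ≤
        2 * ∑ i ∈ Finset.range (n - 2), g i := by
      calc ∑ i ∈ Finset.range (n - 2), min (ℓ i) r
          ≤ ∑ i ∈ Finset.range (n - 2), (g i + g (n - 2 - 1 - i)) := by
            refine Finset.sum_le_sum fun i hi => ?_
            rcases hor i (Finset.mem_range.1 hi) with h | h
            · exact (min_le_min_right r h).trans (le_add_of_nonneg_right (hg0 _))
            · exact (min_le_min_right r h).trans (le_add_of_nonneg_left (hg0 _))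
        _ = 2 * ∑ i ∈ Finset.range (n - 2), g i := by
            rw [Finset.sum_add_distrib, Finset.sum_range_reflect, two_mul]
    have hgs := sum_min_geometric_le hq0 hq1 (by norm_num : (0 : ℝ) ≤ 5 / 6) hKr.le (n - 2)
    have htail : r / (1 - 1 / Real.sqrt 2) ≤ r * (7 / 2) := by
      have : 1 / Real.sqrt 2 ≤ 5 / 7 := by
        rw [div_le_div_iff₀ (by linarith) (by norm_num)]
        linarith
      rw [div_le_iff₀ (by linarith)]
      nlinarith
    have hKmul := mul_le_mul_of_nonneg_right hK hr.le
    rw [hlog8]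
    linarith
end

section
/- Let t ∈ (0, r̄) and D ≥ 0, and let m, n : (0, r̄] → ℝ be measurable functions with m(s) ≥ 0, n(s) ≥ 0 and m(s) + s·n(s) > 0 for all s ∈ (0, r̄], satisfying: m(s) ≤ 6s and n(s) ≤ 3 whenever 0 < s ≤ r̄ and s ≤ D; and m(s) ≤ 6D + 8(s − D)·log₂(8/(s − D)) and n(s) ≤ 4·log₂(8/(s − D)) whenever D < s ≤ r̄. Then ∫_t^{r̄} ds/(m(s) + s·n(s)) ≥ 𝓘(t). -/
open MeasureTheory ENNReal

/-- `𝓘(t) = (ln 2 / 12) · ∫_t^{1/24} ds / (s · ln(8/(s − t)))`. -/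
noncomputable def IotaI (t : ℝ) : ℝ :=
  (Real.log 2 / 12) * ∫ s in t..(1 / 24 : ℝ), 1 / (s * Real.log (8 / (s - t)))

/-- A bounded measurable function divided by the identity is interval integrable away from zero. -/
theorem intervalIntegrable_comp_sub_div {f : ℝ → ℝ} (hf : Measurable f) {r K a : ℝ}
    (hK : ∀ u ∈ Set.Icc 0 r, 0 ≤ f u ∧ f u ≤ K) (ha : 0 < a) (har : a ≤ r) :
    IntervalIntegrable (fun s => f (s - a) / s) volume a r := by
  rw [intervalIntegrable_iff_integrableOn_Ioc_of_le har]
  refine Measure.integrableOn_of_bounded (M := K / a) (by simp)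
    (by fun_prop : Measurable fun s => f (s - a) / s).aestronglyMeasurable ?_
  refine (ae_restrict_iff' measurableSet_Ioc).2 (Filter.Eventually.of_forall fun s hs => ?_)
  obtain ⟨h0, h1⟩ := hK (s - a) ⟨by linarith [hs.1], by linarith [hs.2]⟩
  have hs0 : 0 < s := ha.trans hs.1
  rw [Real.norm_of_nonneg (by positivity)]
  exact div_le_div₀ (h0.trans h1) h1 ha hs.1.le

/-- For nonnegative bounded `g`, the integral `∫_a^r g(s - a) / s` decreases in `a`. -/
theorem integral_comp_sub_div_antitone {g : ℝ → ℝ} (hg : Measurable g) {r K a b : ℝ}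
    (hK : ∀ u ∈ Set.Icc 0 r, 0 ≤ g u ∧ g u ≤ K) (ha : 0 < a) (hab : a ≤ b) (hbr : b ≤ r) :
    ∫ s in b..r, g (s - b) / s ≤ ∫ s in a..r, g (s - a) / s := by
  have shift : ∀ c, ∫ s in c..r, g (s - c) / s = ∫ u in (0 : ℝ)..(r - c), g u / (u + c) := by
    intro c
    have := intervalIntegral.integral_comp_sub_right (a := c) (b := r)
      (fun u => g u / (u + c)) c
    simpa using this
  have integrable : ∀ c, 0 < c → c ≤ r →
      IntervalIntegrable (fun u => g u / (u + c)) volume 0 (r - c) := by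
    intro c hc hcr
    have := (intervalIntegrable_comp_sub_div hg hK hc hcr).comp_add_right c
    simpa using this
  have hia := integrable a ha (hab.trans hbr)
  have hsub : IntervalIntegrable (fun u => g u / (u + a)) volume 0 (r - b) := by
    refine hia.mono_set ?_
    rw [Set.uIcc_of_le (by linarith), Set.uIcc_of_le (by linarith)]
    exact Set.Icc_subset_Icc le_rfl (by linarith)
  rw [shift, shift]
  calc ∫ u in (0 : ℝ)..(r - b), g u / (u + b)
      ≤ ∫ u in (0 : ℝ)..(r - b), g u / (u + a) := by
        refine intervalIntegral.integral_mono_on (by linarith)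
          (integrable b (ha.trans_le hab) hbr) hsub fun u hu => ?_
        have h0 := (hK u ⟨hu.1, by linarith [hu.2]⟩).1
        have : 0 < u + a := by linarith [hu.1]
        gcongr
    _ ≤ ∫ u in (0 : ℝ)..(r - a), g u / (u + a) := by
        refine intervalIntegral.integral_mono_interval le_rfl (by linarith) (by linarith) ?_ hia
        refine (ae_restrict_iff' measurableSet_Ioc).2 (Filter.Eventually.of_forall fun u hu => ?_)
        have h0 := (hK u ⟨hu.1.le, by linarith [hu.2]⟩).1
        have : 0 < u + a := by linarith [hu.1]
        positivity

/-- Moving the base point of `∫_a^r f(s - a) / s` from `a` to `b` costs at most the upper bound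
of `f` times `log (b / a)`. -/
theorem integral_comp_sub_div_le {f : ℝ → ℝ} (hf : Measurable f) {r K a b : ℝ}
    (hK : ∀ u ∈ Set.Icc 0 r, 0 ≤ f u ∧ f u ≤ K) (ha : 0 < a) (hab : a ≤ b) (hbr : b ≤ r) :
    ∫ s in a..r, f (s - a) / s ≤ (∫ s in a..b, K / s) + ∫ s in b..r, f (s - b) / s := by
  have hb : 0 < b := ha.trans_le hab
  have hconst : ∀ c d, 0 < c → c ≤ d →
      IntervalIntegrable (fun s => K / s) volume c d := by
    intro c d hc hcd
    refine ContinuousOn.intervalIntegrable (continuousOn_const.div continuousOn_id fun s hs => ?_)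
    rw [Set.uIcc_of_le hcd] at hs
    exact (hc.trans_le hs.1).ne'
  have hanti := integral_comp_sub_div_antitone (g := fun u => K - f u) (by fun_prop) (K := K)
    (fun u hu => ⟨by linarith [(hK u hu).2], by linarith [(hK u hu).1]⟩) ha hab hbr
  simp only [sub_div] at hanti
  rw [intervalIntegral.integral_sub (hconst b r hb hbr)
      (intervalIntegrable_comp_sub_div hf hK hb hbr),
    intervalIntegral.integral_sub (hconst a r ha (hab.trans hbr))
      (intervalIntegrable_comp_sub_div hf hK ha (hab.trans hbr)),
    ← intervalIntegral.integral_add_adjacent_intervals (hconst a b ha hab)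
      (hconst b r hb hbr)] at hanti
  linarith

/-- A nonnegative interval integral is at most the lower integral of any pointwise majorant. -/
theorem ofReal_intervalIntegral_le_setLIntegral {g h : ℝ → ℝ} {a b : ℝ} (hab : a ≤ b)
    (hg : IntervalIntegrable g volume a b) (hg0 : ∀ s ∈ Set.Ioc a b, 0 ≤ g s)
    (hgh : ∀ s ∈ Set.Ioc a b, g s ≤ h s) :
    ENNReal.ofReal (∫ s in a..b, g s) ≤ ∫⁻ s in Set.Ioc a b, ENNReal.ofReal (h s) := by
  rw [intervalIntegral.integral_of_le hab, ofReal_integral_eq_lintegral_ofReal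
    ((intervalIntegrable_iff_integrableOn_Ioc_of_le hab).1 hg)
    ((ae_restrict_iff' measurableSet_Ioc).2 (Filter.Eventually.of_forall hg0))]
  exact setLIntegral_mono' measurableSet_Ioc fun s hs => ENNReal.ofReal_le_ofReal (hgh s hs)

theorem one_le_log_eight_div {u : ℝ} (hu : 0 < u) (hur : u ≤ 1 / 24) :
    1 ≤ Real.log (8 / u) := by
  rw [Real.le_log_iff_exp_le (by positivity)]
  have h : (8 : ℝ) ≤ 8 / u := by
    rw [le_div_iff₀ hu]
    linarith
  linarith [Real.exp_one_lt_d9]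

/-- Lower bound for the integral `∫_t^{r̄} ds/(m(s) + s·n(s))` (with `r̄ = 1/24`) in
terms of the universal function `𝓘`, for functions `m`, `n` satisfying the bounds
valid at a point at distance `D` from the central vertex of the scar `G_n` of the
`1/n` NBT paper-folding scheme. -/
theorem stmt16 (t : ℝ) (ht : t ∈ Set.Ioo (0 : ℝ) (1 / 24)) (D : ℝ) (hD : 0 ≤ D)
    (m n : ℝ → ℝ)
    (hm_meas : Measurable ((Set.Ioc (0 : ℝ) (1 / 24)).restrict m))
    (hn_meas : Measurable ((Set.Ioc (0 : ℝ) (1 / 24)).restrict n))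
    (hpos : ∀ s ∈ Set.Ioc (0 : ℝ) (1 / 24), 0 ≤ m s ∧ 0 ≤ n s ∧ 0 < m s + s * n s)
    (hsmall : ∀ s ∈ Set.Ioc (0 : ℝ) (1 / 24), s ≤ D → m s ≤ 6 * s ∧ n s ≤ 3)
    (hbig : ∀ s ∈ Set.Ioc (0 : ℝ) (1 / 24), D < s →
      m s ≤ 6 * D + 8 * (s - D) * Real.logb 2 (8 / (s - D)) ∧
      n s ≤ 4 * Real.logb 2 (8 / (s - D))) :
    ENNReal.ofReal (IotaI t) ≤
      ∫⁻ s in Set.Ioc t (1 / 24 : ℝ), ENNReal.ofReal (1 / (m s + s * n s)) := by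
  obtain ⟨ht0, htr⟩ := ht
  have hlog2 : 0 < Real.log 2 := Real.log_pos (by norm_num)
  have hlog2' : Real.log 2 < 1 := by linarith [Real.log_two_lt_d9]
  set c : ℝ := Real.log 2 / 12 with hc
  have hc0 : 0 < c := by positivity
  set f : ℝ → ℝ := fun u => c / Real.log (8 / u) with hf
  have hf_meas : Measurable f :=
    measurable_const.div (Real.measurable_log.comp (measurable_const.div measurable_id))
  have hf_bound : ∀ u ∈ Set.Icc (0 : ℝ) (1 / 24), 0 ≤ f u ∧ f u ≤ 1 / 9 := by
    rintro u ⟨hu0, hur⟩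
    rcases hu0.eq_or_lt with rfl | hu0
    · simp [hf]
    · have h1 := one_le_log_eight_div hu0 hur
      refine ⟨div_nonneg hc0.le (by linarith), ?_⟩
      rw [hf, div_le_iff₀ (by linarith)]
      linarith
  obtain ⟨E, htE, hEr, hlow, hhigh⟩ : ∃ E, t ≤ E ∧ E ≤ 1 / 24 ∧
      (∀ s ∈ Set.Ioc t E, s ≤ D) ∧ (∀ s ∈ Set.Ioc E (1 / 24), D ≤ E) := by
    refine ⟨max t (min D (1 / 24)), le_max_left _ _, max_le htr.le (min_le_right _ _), ?_, ?_⟩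
    · rintro s ⟨h1, h2⟩
      rcases le_max_iff.1 h2 with h | h
      · linarith
      · exact h.trans (min_le_left _ _)
    · rintro s ⟨h1, h2⟩
      have h3 := (le_max_right _ _).trans_lt h1
      rcases min_lt_iff.1 h3 with h | h
      · exact le_max_of_le_right (le_min le_rfl (h.le.trans h2))
      · linarith
  have hE0 : 0 < E := ht0.trans_le htE
  have hI : IotaI t ≤ (∫ s in t..E, (1 / 9) / s) + ∫ s in E..(1 / 24), f (s - E) / s := by
    refine le_of_eq_of_le ?_ (integral_comp_sub_div_le hf_meas hf_bound ht0 htE hEr)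
    rw [IotaI, ← intervalIntegral.integral_const_mul]
    congr 1
    funext s
    rw [hf, div_div, mul_one_div, mul_comm s]
  have hsplit : Set.Ioc t (1 / 24) = Set.Ioc t E ∪ Set.Ioc E (1 / 24) :=
    (Set.Ioc_union_Ioc_eq_Ioc htE hEr).symm
  refine (ENNReal.ofReal_le_ofReal hI).trans (ENNReal.ofReal_add_le.trans ?_)
  rw [hsplit, lintegral_union measurableSet_Ioc (Set.Ioc_disjoint_Ioc_of_le le_rfl)]
  refine add_le_add (ofReal_intervalIntegral_le_setLIntegral htE ?_ ?_ ?_)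
    (ofReal_intervalIntegral_le_setLIntegral hEr
      (intervalIntegrable_comp_sub_div hf_meas hf_bound hE0 hEr) ?_ ?_)
  · refine ContinuousOn.intervalIntegrable (continuousOn_const.div continuousOn_id fun s hs => ?_)
    rw [Set.uIcc_of_le htE] at hs
    exact (ht0.trans_le hs.1).ne'
  · intro s hs
    have : 0 < s := ht0.trans hs.1
    positivity
  · intro s hs
    have hs0 : 0 < s := ht0.trans hs.1
    have hs' : s ∈ Set.Ioc (0 : ℝ) (1 / 24) := ⟨hs0, hs.2.trans hEr⟩
    obtain ⟨h1, h2⟩ := hsmall s hs' (hlow s hs)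
    rw [div_div]
    refine one_div_le_one_div_of_le (hpos s hs').2.2 ?_
    nlinarith
  · intro s hs
    have hs0 : 0 < s := hE0.trans hs.1
    exact div_nonneg (hf_bound (s - E) ⟨by linarith [hs.1], by linarith [hs.2]⟩).1 hs0.le
  · intro s hs
    have hs0 : 0 < s := hE0.trans hs.1
    have hDE := hhigh s hs
    have hDs : 0 < s - D := by linarith [hs.1]
    have hEs : 0 < s - E := by linarith [hs.1]
    have hs' : s ∈ Set.Ioc (0 : ℝ) (1 / 24) := ⟨hs0, hs.2⟩
    obtain ⟨h1, h2⟩ := hbig s hs' (by linarith)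
    have hlogD : 1 ≤ Real.log (8 / (s - D)) := one_le_log_eight_div hDs (by linarith [hs.2])
    have hmono : Real.log (8 / (s - D)) ≤ Real.log (8 / (s - E)) := by
      gcongr
    have hL : 1 ≤ Real.logb 2 (8 / (s - D)) := by
      rw [Real.logb, le_div_iff₀ hlog2]
      linarith
    have hle : m s + s * n s ≤ 12 * s * Real.logb 2 (8 / (s - D)) := by
      nlinarith [mul_le_mul_of_nonneg_left h2 hs0.le, mul_le_mul_of_nonneg_left hL hD]
    calc f (s - E) / s ≤ c / Real.log (8 / (s - D)) / s := by
          simp only [hf]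
          gcongr
      _ = 1 / (12 * s * Real.logb 2 (8 / (s - D))) := by
          rw [Real.logb, hc]
          field_simp
      _ ≤ 1 / (m s + s * n s) := one_div_le_one_div_of_le (hpos s hs').2.2 hle
end

section
/- The function 𝓘 is strictly decreasing on (0, r̄), and 𝓘(t) → +∞ as t → 0⁺. -/
theorem one_lt_log_eight_div {u : ℝ} (h0 : 0 < u) (h1 : u ≤ 1) : 1 < Real.log (8 / u) := by
  rw [Real.lt_log_iff_exp_lt (by positivity), lt_div_iff₀ h0]
  nlinarith [Real.exp_one_lt_d9, Real.exp_pos 1]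

theorem IotaI_eq_integral (t : ℝ) :
    IotaI t = (Real.log 2 / 12) *
      ∫ u in (0 : ℝ)..(1 / 24 - t), 1 / ((u + t) * Real.log (8 / u)) := by
  have h := intervalIntegral.integral_comp_add_right (a := 0) (b := 1 / 24 - t)
    (fun s => 1 / (s * Real.log (8 / (s - t)))) t
  simp only [add_sub_cancel_right, zero_add, sub_add_cancel] at h
  rw [IotaI, h]

theorem intervalIntegrable_one_div_add_mul_log {t a b : ℝ} (ht : 0 < t) (ha : 0 ≤ a)
    (hab : a ≤ b) (hb : b ≤ 1) :
    IntervalIntegrable (fun u => 1 / ((u + t) * Real.log (8 / u))) MeasureTheory.volume a b := by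
  rw [intervalIntegrable_iff_integrableOn_Ioc_of_le hab]
  refine MeasureTheory.Measure.integrableOn_of_bounded (M := 1 / t) (by simp)
    (by measurability) ?_
  refine (MeasureTheory.ae_restrict_iff' measurableSet_Ioc).2 (.of_forall fun u hu => ?_)
  have hu0 : 0 < u := ha.trans_lt hu.1
  have hl := one_lt_log_eight_div hu0 (hu.2.trans hb)
  rw [Real.norm_of_nonneg (by positivity)]
  exact one_div_le_one_div_of_le ht (by nlinarith)

theorem integral_one_div_mul_log {a b : ℝ} (ha : 0 < a) (hab : a ≤ b) (hb : b ≤ 1) :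
    IntervalIntegrable (fun u => 1 / (u * Real.log (8 / u))) MeasureTheory.volume a b ∧
    ∫ u in a..b, 1 / (u * Real.log (8 / u)) =
      Real.log (Real.log (8 / a)) - Real.log (Real.log (8 / b)) := by
  have hpos : ∀ u ∈ Set.uIcc a b, 0 < u ∧ 1 < Real.log (8 / u) := by
    intro u hu
    rw [Set.uIcc_of_le hab] at hu
    have hu0 := ha.trans_le hu.1
    exact ⟨hu0, one_lt_log_eight_div hu0 (hu.2.trans hb)⟩
  have hint : IntervalIntegrable (fun u => 1 / (u * Real.log (8 / u)))
      MeasureTheory.volume a b := by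
    refine ContinuousOn.intervalIntegrable fun u hu => ?_
    obtain ⟨hu0, hl⟩ := hpos u hu
    have h8 : 8 / u ≠ 0 := by positivity
    have hne : u * Real.log (8 / u) ≠ 0 := by positivity
    have hu' := hu0.ne'
    exact ContinuousAt.continuousWithinAt (by fun_prop (disch := assumption))
  refine ⟨hint, ?_⟩
  rw [intervalIntegral.integral_eq_sub_of_hasDerivAt
    (f := fun u => -Real.log (Real.log (8 / u))) _ hint]
  · ring
  · intro u hu
    obtain ⟨hu0, hl⟩ := hpos u hu
    have h8 : 8 / u ≠ 0 := by positivity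
    have hl' : Real.log (8 / u) ≠ 0 := by positivity
    have h := ((((hasDerivAt_inv hu0.ne').const_mul 8).log
      (by rwa [← div_eq_mul_inv])).log (by rwa [← div_eq_mul_inv])).neg
    simp only [← div_eq_mul_inv] at h
    refine h.congr_deriv ?_
    field_simp

theorem strictAntiOn_IotaI : StrictAntiOn IotaI (Set.Ioo (0 : ℝ) (1 / 24)) := by
  rintro x ⟨hx0, hx1⟩ y ⟨hy0, hy1⟩ hxy
  rw [IotaI_eq_integral, IotaI_eq_integral]
  refine mul_lt_mul_of_pos_left ?_ (div_pos (Real.log_pos (by norm_num)) (by norm_num))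
  have h1 := intervalIntegrable_one_div_add_mul_log (b := 1 / 24 - y) hx0 le_rfl
    (by linarith) (by linarith)
  have h2 := intervalIntegrable_one_div_add_mul_log (a := 1 / 24 - y) (b := 1 / 24 - x) hx0
    (by linarith) (by linarith) (by linarith)
  have h3 := intervalIntegrable_one_div_add_mul_log (b := 1 / 24 - y) hy0 le_rfl
    (by linarith) (by linarith)
  rw [← intervalIntegral.integral_add_adjacent_intervals h1 h2]
  have hle : ∫ u in (0 : ℝ)..(1 / 24 - y), 1 / ((u + y) * Real.log (8 / u)) ≤
      ∫ u in (0 : ℝ)..(1 / 24 - y), 1 / ((u + x) * Real.log (8 / u)) := by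
    refine intervalIntegral.integral_mono_on_of_le_Ioo (by linarith) h3 h1 fun u hu => ?_
    have hu0 := hu.1
    have hl := one_lt_log_eight_div hu0 (by linarith [hu.2])
    gcongr
  have hpos : 0 < ∫ u in (1 / 24 - y)..(1 / 24 - x), 1 / ((u + x) * Real.log (8 / u)) := by
    refine intervalIntegral.intervalIntegral_pos_of_pos_on h2 (fun u hu => ?_) (by linarith)
    have hu0 : 0 < u := by linarith [hu.1]
    have hl := one_lt_log_eight_div hu0 (by linarith [hu.2])
    positivity
  linarith

theorem le_IotaI {t : ℝ} (ht : 0 < t) (ht' : t < 1 / 48) :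
    (Real.log 2 / 12) * (1 / 2 * (Real.log (Real.log (8 / t)) -
      Real.log (Real.log (8 / (1 / 48))))) ≤ IotaI t := by
  rw [IotaI_eq_integral]
  refine mul_le_mul_of_nonneg_left ?_ (div_nonneg (Real.log_nonneg (by norm_num)) (by norm_num))
  obtain ⟨hint, heq⟩ := integral_one_div_mul_log ht ht'.le (by norm_num)
  rw [← heq, ← intervalIntegral.integral_const_mul]
  calc
    _ ≤ ∫ u in t..(1 / 48), 1 / ((u + t) * Real.log (8 / u)) := by
      refine intervalIntegral.integral_mono_on_of_le_Ioo ht'.le (hint.const_mul _)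
        (intervalIntegrable_one_div_add_mul_log ht ht.le ht'.le (by norm_num)) fun u hu => ?_
      have hu0 : 0 < u := ht.trans hu.1
      have hl := one_lt_log_eight_div hu0 (by linarith [hu.2])
      rw [one_div_mul_one_div, ← mul_assoc]
      gcongr
      linarith [hu.1]
    _ ≤ _ := by
      refine intervalIntegral.integral_mono_interval ht.le ht'.le (by linarith) ?_
        (intervalIntegrable_one_div_add_mul_log ht le_rfl (by linarith) (by linarith))
      refine (MeasureTheory.ae_restrict_iff' measurableSet_Ioc).2 (.of_forall fun u hu => ?_)
      have hu0 : 0 < u := hu.1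
      have hl := one_lt_log_eight_div hu0 (by linarith [hu.2])
      simp only [Pi.zero_apply]
      positivity

theorem tendsto_IotaI_atTop :
    Filter.Tendsto IotaI (nhdsWithin 0 (Set.Ioi 0)) Filter.atTop := by
  have h8 : Filter.Tendsto (fun t : ℝ => 8 / t) (nhdsWithin 0 (Set.Ioi 0)) Filter.atTop := by
    simpa only [div_eq_mul_inv] using
      tendsto_inv_nhdsGT_zero.const_mul_atTop (show (0 : ℝ) < 8 by norm_num)
  have hlog := Real.tendsto_log_atTop.comp (Real.tendsto_log_atTop.comp h8)
  have hlow := ((Filter.tendsto_atTop_add_const_right _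
    (-Real.log (Real.log (8 / (1 / 48)))) hlog).const_mul_atTop
    (show (0 : ℝ) < 1 / 2 by norm_num)).const_mul_atTop
    (div_pos (Real.log_pos one_lt_two) (show (0 : ℝ) < 12 by norm_num))
  refine Filter.tendsto_atTop_mono' _ ?_ hlow
  filter_upwards [Ioo_mem_nhdsGT (show (0 : ℝ) < 1 / 48 by norm_num)] with t ht
  exact le_IotaI ht.1 ht.2

/-- `𝓘` is strictly decreasing on `(0, 1/24)` and `𝓘(t) → +∞` as `t → 0⁺`. -/
theorem stmt17 :
    StrictAntiOn IotaI (Set.Ioo (0 : ℝ) (1 / 24)) ∧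
    Filter.Tendsto IotaI (nhdsWithin 0 (Set.Ioi 0)) Filter.atTop :=
  ⟨strictAntiOn_IotaI, tendsto_IotaI_atTop⟩
end

section
/- The function x ↦ x · exp((2π/5) · 𝓘(192·x)) is monotone increasing on the interval (0, 1/4608]. -/
theorem inv_log_mem_Icc {u : ℝ} (h0 : 0 ≤ u) (h1 : u ≤ 1 / 24) :
    (Real.log (8 / u))⁻¹ ∈ Set.Icc (0 : ℝ) 1 := by
  rcases h0.eq_or_lt with rfl | h0
  · simp
  · have h : (1 : ℝ) ≤ Real.log (8 / u) := by
      rw [Real.le_log_iff_exp_le (by positivity)]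
      have h3 : (3 : ℝ) ≤ 8 / u := by
        rw [le_div_iff₀ h0]
        linarith
      linarith [Real.exp_one_lt_d9]
    exact ⟨by positivity, inv_le_one_of_one_le₀ h⟩

theorem intervalIntegrable_inv_add {t c : ℝ} (ht : 0 < t) (hc : 0 ≤ c) :
    IntervalIntegrable (fun u : ℝ => (u + t)⁻¹) MeasureTheory.volume 0 c := by
  apply ContinuousOn.intervalIntegrable
  rw [Set.uIcc_of_le hc]
  apply ContinuousOn.inv₀ (by fun_prop)
  intro u hu
  linarith [hu.1]

theorem intervalIntegrable_inv_add_mul_inv_log {t c : ℝ} (ht : 0 < t) (hc : 0 ≤ c)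
    (hc' : c ≤ 1 / 24) :
    IntervalIntegrable (fun u : ℝ => (u + t)⁻¹ * (Real.log (8 / u))⁻¹)
      MeasureTheory.volume 0 c := by
  apply (intervalIntegrable_inv_add ht hc).mono_fun
  · exact Measurable.aestronglyMeasurable (by fun_prop)
  · filter_upwards [MeasureTheory.ae_restrict_mem measurableSet_uIoc] with u hu
    rw [Set.uIoc_of_le hc] at hu
    have h := inv_log_mem_Icc hu.1.le (hu.2.trans hc')
    rw [norm_mul, Real.norm_of_nonneg h.1]
    exact mul_le_of_le_one_right (norm_nonneg _) h.2

theorem integral_inv_mul_log_sub_eq (t r : ℝ) :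
    ∫ s in t..r, 1 / (s * Real.log (8 / (s - t))) =
      ∫ u in (0 : ℝ)..(r - t), (u + t)⁻¹ * (Real.log (8 / u))⁻¹ := by
  have h := intervalIntegral.integral_comp_sub_right (a := t) (b := r)
    (fun u : ℝ => (u + t)⁻¹ * (Real.log (8 / u))⁻¹) t
  simp only [sub_self, sub_add_cancel] at h
  rw [← h]
  simp only [one_div, mul_inv]

theorem integral_inv_add_eq_log {t r : ℝ} (ht : 0 < t) (hr : t ≤ r) :
    ∫ u in (0 : ℝ)..(r - t), (u + t)⁻¹ = Real.log r - Real.log t := by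
  rw [intervalIntegral.integral_comp_add_right (fun u : ℝ => u⁻¹), zero_add, sub_add_cancel,
    integral_inv_of_pos ht (ht.trans_le hr), Real.log_div (ht.trans_le hr).ne' ht.ne']

theorem integral_inv_mul_log_sub_add_log_le {a b : ℝ} (ha : 0 < a) (hab : a ≤ b)
    (hb : b ≤ 1 / 24) :
    (∫ s in a..(1 / 24 : ℝ), 1 / (s * Real.log (8 / (s - a)))) + Real.log a ≤
      (∫ s in b..(1 / 24 : ℝ), 1 / (s * Real.log (8 / (s - b)))) + Real.log b := by
  have hb0 : 0 < b := ha.trans_le hab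
  have hi : ∀ t c : ℝ, 0 < t → 0 ≤ c → c ≤ 1 / 24 → IntervalIntegrable
      (fun u : ℝ => (u + t)⁻¹ - (u + t)⁻¹ * (Real.log (8 / u))⁻¹) MeasureTheory.volume 0 c :=
    fun t c ht hc hc' => (intervalIntegrable_inv_add ht hc).sub
      (intervalIntegrable_inv_add_mul_inv_log ht hc hc')
  have key : (∫ u in (0 : ℝ)..(1 / 24 - b), ((u + b)⁻¹ - (u + b)⁻¹ * (Real.log (8 / u))⁻¹)) ≤
      ∫ u in (0 : ℝ)..(1 / 24 - a), ((u + a)⁻¹ - (u + a)⁻¹ * (Real.log (8 / u))⁻¹) := by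
    calc
      _ ≤ ∫ u in (0 : ℝ)..(1 / 24 - b), ((u + a)⁻¹ - (u + a)⁻¹ * (Real.log (8 / u))⁻¹) := by
        apply intervalIntegral.integral_mono_on (by linarith)
          (hi b _ hb0 (by linarith) (by linarith)) (hi a _ ha (by linarith) (by linarith))
        intro u hu
        have h := inv_log_mem_Icc hu.1 (by linarith [hu.2])
        have h2 : (u + b)⁻¹ ≤ (u + a)⁻¹ := inv_anti₀ (by linarith [hu.1]) (by linarith)
        nlinarith [h.2]
      _ ≤ _ := by
        apply intervalIntegral.integral_mono_interval le_rfl (by linarith) (by linarith) _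
          (hi a _ ha (by linarith) (by linarith))
        filter_upwards [MeasureTheory.ae_restrict_mem measurableSet_Ioc] with u hu
        have h := inv_log_mem_Icc hu.1.le (by linarith [hu.2])
        have h2 : 0 ≤ (u + a)⁻¹ := inv_nonneg.2 (by linarith [hu.1])
        exact sub_nonneg.2 (mul_le_of_le_one_right h2 h.2)
  rw [intervalIntegral.integral_sub (intervalIntegrable_inv_add hb0 (by linarith))
      (intervalIntegrable_inv_add_mul_inv_log hb0 (by linarith) (by linarith)),
    intervalIntegral.integral_sub (intervalIntegrable_inv_add ha (by linarith))
      (intervalIntegrable_inv_add_mul_inv_log ha (by linarith) (by linarith)),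
    integral_inv_add_eq_log hb0 hb, integral_inv_add_eq_log ha (hab.trans hb)] at key
  rw [integral_inv_mul_log_sub_eq, integral_inv_mul_log_sub_eq]
  linarith

/-- The function `x ↦ x · exp((2π/5) · 𝓘(192·x))` is monotone increasing on
`(0, 1/4608]`. -/
theorem stmt18 :
    MonotoneOn (fun x : ℝ => x * Real.exp ((2 * Real.pi / 5) * IotaI (192 * x)))
      (Set.Ioc (0 : ℝ) (1 / 4608)) := by
  intro x hx y hy hxy
  have hx0 : 0 < x := hx.1
  have hy0 : 0 < y := hy.1
  have key := integral_inv_mul_log_sub_add_log_le (a := 192 * x) (b := 192 * y)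
    (by linarith) (by linarith) (by linarith [hy.2])
  rw [Real.log_mul (by norm_num) hx0.ne', Real.log_mul (by norm_num) hy0.ne'] at key
  have hlog : Real.log x ≤ Real.log y := Real.log_le_log hx0 hxy
  have hC0 : 0 ≤ 2 * Real.pi / 5 * (Real.log 2 / 12) := by positivity
  have hC1 : 2 * Real.pi / 5 * (Real.log 2 / 12) ≤ 1 := by
    have h1 : 2 * Real.pi / 5 ≤ 2 := by linarith [Real.pi_lt_four]
    have h2 : Real.log 2 / 12 ≤ 1 / 2 := by linarith [Real.log_two_lt_d9]
    calc
      _ ≤ (2 : ℝ) * (1 / 2) := mul_le_mul h1 h2 (by positivity) (by norm_num)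
      _ = 1 := by norm_num
  simp only [IotaI, ← mul_assoc]
  rw [← Real.log_le_log_iff (by positivity) (by positivity),
    Real.log_mul hx0.ne' (Real.exp_ne_zero _), Real.log_mul hy0.ne' (Real.exp_ne_zero _),
    Real.log_exp, Real.log_exp]
  nlinarith [mul_le_mul_of_nonneg_left key hC0,
    mul_nonneg (sub_nonneg.2 hC1) (sub_nonneg.2 hlog)]
end
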